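/- arXiv:1012.2186 — 4 statements merged into one kernel-verified Lean document; each statement's English description precedes it below -/
import Mathlib

section
/- Let K be an algebraically closed field, n ≥ 1, and 1 ≤ m ≤ d with m ≤ 2n-1. Then for every nonzero homogeneous F ∈ K[x₀,…,xₙ] of degree d, there exists a point p ∈ Pⁿ and a line L through p such that L intersects the hypersurface {F=0} at p with multiplicity ≥ m. -/
open Polynomial

universe u

section
variable {R S : Type*} [CommRing R] [CommRing S] {σ : Type*}

noncomputable def LL (F : MvPolynomial σ R) (a b : σ → R) : R[X] :=
  MvPolynomial.aeval (fun i => C (a i) + C (b i) * X) F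

theorem LL_map (φ : R →+* S) (F : MvPolynomial σ R) (a b : σ → R) :
    (LL F a b).map φ = LL (MvPolynomial.map φ F) (fun i => φ (a i)) (fun i => φ (b i)) := by
  unfold LL
  induction F using MvPolynomial.induction_on with
  | C r => simp
  | add p q hp hq => simp [hp, hq]
  | mul_X p i hp => simp [hp]

theorem good_map (φ : R →+* S) {m : ℕ} {F : MvPolynomial σ R} {a b : σ → R}
    (h : X ^ m ∣ LL F a b) :
    X ^ m ∣ LL (MvPolynomial.map φ F) (fun i => φ (a i)) (fun i => φ (b i)) := by
  rw [← LL_map]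
  simpa using Polynomial.map_dvd φ h

theorem good_of_inj (φ : R →+* S) (hφ : Function.Injective φ) {m : ℕ} {F : MvPolynomial σ R}
    {a b : σ → R}
    (h : X ^ m ∣ LL (MvPolynomial.map φ F) (fun i => φ (a i)) (fun i => φ (b i))) :
    X ^ m ∣ LL F a b := by
  rw [← LL_map] at h
  rw [X_pow_dvd_iff] at h ⊢
  intro d hd
  have := h d hd
  rw [coeff_map] at this
  exact hφ (by simpa using this)

theorem aeval_LL [Algebra R S] (F : MvPolynomial σ R) (a b : σ → R) (r : S) :
    aeval r (LL F a b) =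
      MvPolynomial.aeval (fun i => algebraMap R S (a i) + algebraMap R S (b i) * r) F := by
  unfold LL
  induction F using MvPolynomial.induction_on with
  | C r => simp
  | add p q hp hq => simp [hp, hq]
  | mul_X p i hp => simp [hp]

theorem hom_scale [Algebra R S] {d : ℕ} {F : MvPolynomial σ R} (hF : F.IsHomogeneous d)
    (c : S) (x : σ → S) :
    MvPolynomial.aeval (fun i => c * x i) F = c ^ d * MvPolynomial.aeval x F := by
  rw [MvPolynomial.aeval_def, MvPolynomial.aeval_def, MvPolynomial.eval₂_eq, MvPolynomial.eval₂_eq,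
    Finset.mul_sum]
  refine Finset.sum_congr rfl fun s hs => ?_
  have h1 : ∑ i ∈ s.support, s i = d := by
    have := hF (MvPolynomial.mem_support_iff.mp hs)
    rw [← this, Finsupp.weight_apply, Finsupp.sum]
    simp
  simp only [mul_pow, Finset.prod_mul_distrib, Finset.prod_pow_eq_pow_sum, h1]
  ring
end

section
variable {R : Type u} [CommRing R] {σ : Type*}

theorem good_iff (m : ℕ) (F : MvPolynomial σ R) (a b : σ → R) :
    X ^ m ∣ LL F a b ↔ ∀ (S : Type u) [CommRing S] [Algebra R S] (r : S), r ^ m = 0 →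
      MvPolynomial.aeval (fun i => algebraMap R S (a i) + algebraMap R S (b i) * r) F = 0 := by
  constructor
  · rintro ⟨q, hq⟩ S _ _ r hr
    rw [← aeval_LL, hq]
    simp [hr]
  · intro h
    have := h (AdjoinRoot (X ^ m : R[X])) (AdjoinRoot.root _) (by
      have := AdjoinRoot.eval₂_root (X ^ m : R[X])
      simpa using this)
    rw [← aeval_LL, AdjoinRoot.aeval_eq, AdjoinRoot.mk_eq_zero] at this
    exact this

theorem good_shear {m d : ℕ} {F : MvPolynomial σ R} (hF : F.IsHomogeneous d) {a b : σ → R} (c : R)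
    (h : X ^ m ∣ LL F a b) : X ^ m ∣ LL F a (fun i => b i + c * a i) := by
  rw [good_iff] at h ⊢
  intro S _ _ r hr
  have hu : IsUnit (1 + algebraMap R S c * r) := by
    apply IsNilpotent.isUnit_one_add
    exact ⟨m, by rw [mul_pow, hr, mul_zero]⟩
  obtain ⟨w, hw⟩ := hu.exists_right_inv
  have h2 := h S (w * r) (by rw [mul_pow, hr, mul_zero])
  have h3 := hom_scale hF (1 + algebraMap R S c * r)
    (fun i => algebraMap R S (a i) + algebraMap R S (b i) * (w * r))
  rw [h2, mul_zero] at h3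
  rw [← h3]
  congr 2
  funext i
  simp only [map_add, map_mul]
  linear_combination (- algebraMap R S (b i) * r) * hw

theorem good_scale_b {m : ℕ} {F : MvPolynomial σ R} {a b : σ → R} (c : R)
    (h : X ^ m ∣ LL F a b) : X ^ m ∣ LL F a (fun i => c * b i) := by
  rw [good_iff] at h ⊢
  intro S _ _ r hr
  rw [← h S (algebraMap R S c * r) (by rw [mul_pow, hr, mul_zero])]
  congr 2
  funext i
  simp only [map_mul]
  ring

theorem good_scale_a {m d : ℕ} {F : MvPolynomial σ R} (hF : F.IsHomogeneous d) {a b : σ → R} (c : R)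
    (h : X ^ m ∣ LL F a b) : X ^ m ∣ LL F (fun i => c * a i) (fun i => c * b i) := by
  rw [good_iff] at h ⊢
  intro S _ _ r hr
  have h3 := hom_scale hF (algebraMap R S c)
    (fun i => algebraMap R S (a i) + algebraMap R S (b i) * r)
  rw [h S r hr, mul_zero] at h3
  rw [← h3]
  congr 2
  funext i
  simp only [map_mul]
  ring
end

/-- Descent to the algebraically closed base. -/
theorem descend {K k : Type*} [Field K] [IsAlgClosed K] [Field k] [Algebra K k] {m N : ℕ}
    (F : MvPolynomial (Fin N) K) (a b : Fin N → k) 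
    (h : X ^ m ∣ LL (MvPolynomial.map (algebraMap K k) F) a b) :
    ∃ (B : Subalgebra K k) (φ : B →ₐ[K] K) (ha : ∀ i, a i ∈ B) (hb : ∀ i, b i ∈ B),
      X ^ m ∣ LL F (fun i => φ ⟨a i, ha i⟩) (fun i => φ ⟨b i, hb i⟩) := by
  classical
  let B : Subalgebra K k := Algebra.adjoin K (Set.range a ∪ Set.range b)
  have hfg : B.FG := Subalgebra.fg_def.mpr ⟨_, Set.toFinite _, rfl⟩
  have : Algebra.FiniteType K B := (Subalgebra.fg_iff_finiteType _).mp hfg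
  obtain ⟨M, hM⟩ := Ideal.exists_maximal B
  let _ := Ideal.Quotient.field M
  have := finite_of_finite_type_of_isJacobsonRing K (B ⧸ M)
  have hbij := IsAlgClosed.algebraMap_bijective_of_isIntegral (k := K) (K := B ⧸ M)
  let e := AlgEquiv.ofBijective (Algebra.ofId K (B ⧸ M)) hbij
  let φ : B →ₐ[K] K := e.symm.toAlgHom.comp (Ideal.Quotient.mkₐ K M)
  have ha : ∀ i, a i ∈ B := fun i => Algebra.subset_adjoin (Or.inl ⟨i, rfl⟩)
  have hb : ∀ i, b i ∈ B := fun i => Algebra.subset_adjoin (Or.inr ⟨i, rfl⟩)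
  refine ⟨B, φ, ha, hb, ?_⟩
  have h1 : X ^ m ∣ LL (MvPolynomial.map (algebraMap K B) F) (fun i => (⟨a i, ha i⟩ : B))
      (fun i => (⟨b i, hb i⟩ : B)) := by
    apply good_of_inj (algebraMap B k) Subtype.val_injective
    rw [MvPolynomial.map_map, ← IsScalarTower.algebraMap_eq]
    exact h
  have h2 := good_map (φ : B →+* K) h1
  rw [MvPolynomial.map_map] at h2
  have : (φ : B →+* K).comp (algebraMap K B) = RingHom.id K := by
    ext x; simp
  rw [this, MvPolynomial.map_id] at h2
  exact h2

theorem height_vars (K : Type*) [Field K] (N : ℕ) :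
    (N : ℕ∞) ≤ (RingHom.ker (MvPolynomial.constantCoeff (R := K) (σ := Fin N))).height := by
  let P : ℕ → Ideal (MvPolynomial (Fin N) K) := fun k =>
    RingHom.ker (MvPolynomial.aeval (R := K)
      (fun i : Fin N => if i.val < k then (0 : MvPolynomial (Fin N) K) else MvPolynomial.X i))
  have hp : ∀ k, (P k).IsPrime := fun k => RingHom.ker_isPrime _
  have key : ∀ k, k ≤ N → (k : ℕ∞) ≤ (P k).height := by
    intro k
    induction k with
    | zero => simp
    | succ k ih =>
      intro hk
      have h1 : P k < P (k + 1) := by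
        refine lt_of_le_of_ne ?_ ?_
        · intro p hpp
          simp only [P, RingHom.mem_ker] at hpp ⊢
          have : MvPolynomial.aeval (R := K)
              (fun i : Fin N => if i.val < k + 1 then (0 : MvPolynomial (Fin N) K) else MvPolynomial.X i)
              = (MvPolynomial.aeval (R := K)
              (fun i : Fin N => if i.val < k + 1 then (0 : MvPolynomial (Fin N) K) else MvPolynomial.X i)).comp
              (MvPolynomial.aeval (R := K)
              (fun i : Fin N => if i.val < k then (0 : MvPolynomial (Fin N) K) else MvPolynomial.X i)) := by
            ext i : 1
            by_cases h : i.val < k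
            · simp [h, h.le]
            · simp [h]
          rw [this, AlgHom.comp_apply, hpp, map_zero]
        · intro h
          have : (MvPolynomial.X ⟨k, hk⟩ : MvPolynomial (Fin N) K) ∈ P (k+1) := by
            simp [P, RingHom.mem_ker]
          rw [← h] at this
          simp [P, RingHom.mem_ker] at this
      have := Ideal.height_add_one_le_of_lt_of_isPrime h1
      push_cast
      exact le_trans (add_le_add_left (ih (by omega)) 1) this
  refine (key N le_rfl).trans (Ideal.height_mono ?_)
  intro p hpp
  simp only [P, RingHom.mem_ker] at hpp ⊢
  simp only [Fin.is_lt, if_true] at hpp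
  have h2 : (MvPolynomial.aeval fun _ : Fin N => (0 : MvPolynomial (Fin N) K)) p
      = MvPolynomial.C (MvPolynomial.constantCoeff p) := by
    simpa using MvPolynomial.aeval_zero' (R := K) (S₁ := MvPolynomial (Fin N) K) p
  rw [h2] at hpp
  simpa using hpp

theorem special {K Ω : Type*} [Field K] [IsAlgClosed K] [Field Ω] [Algebra K Ω] {N d m : ℕ}
    (F F0 : MvPolynomial (Fin N) K) (hF : F.IsHomogeneous d) (hF0 : F0.IsHomogeneous d)
    (ε : Ω) (hε : Transcendental K ε) (a b : Fin N → Ω) (i0 i1 : Fin N) (ha0 : a i0 = 1)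
    (hb0 : b i0 = 0) (hb1 : b i1 = 1)
    (h : X ^ m ∣ LL (MvPolynomial.map (algebraMap K Ω) F0 +
      MvPolynomial.C ε * MvPolynomial.map (algebraMap K Ω) F) a b) :
    ∃ a b : Fin N → K, LinearIndependent K ![a, b] ∧ X ^ m ∣ LL F a b := by
  classical
  have hε0 : ε ≠ 0 := by
    rintro rfl
    exact hε (isAlgebraic_zero)
  set s : Ω := ε⁻¹ with hs
  have hst : Transcendental K s := fun h => hε (by simpa [hs] using h.inv)
  set H : MvPolynomial (Fin N) Ω := MvPolynomial.map (algebraMap K Ω) F +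
      MvPolynomial.C s * MvPolynomial.map (algebraMap K Ω) F0 with hH
  have hHh : H.IsHomogeneous d := by
    refine (hF.map _).add ?_
    simpa using (MvPolynomial.isHomogeneous_C (Fin N) s).mul (hF0.map (algebraMap K Ω))
  have hg : X ^ m ∣ LL H a b := by
    have : H = MvPolynomial.C s * (MvPolynomial.map (algebraMap K Ω) F0 +
      MvPolynomial.C ε * MvPolynomial.map (algebraMap K Ω) F) := by
      have hse : s * ε = 1 := inv_mul_cancel₀ hε0
      rw [mul_add, ← mul_assoc, ← map_mul, hse, map_one, one_mul, hH, add_comm]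
    rw [this]
    unfold LL at h ⊢
    rw [map_mul]
    exact h.mul_left _
  let A : Subalgebra K Ω := Algebra.adjoin K {s}
  have hsA : s ∈ A := Algebra.subset_adjoin rfl
  let I : Ideal A.toSubring := Ideal.span {⟨s, hsA⟩}
  have hI : I ≠ ⊤ := by
    intro hI
    rw [Ideal.eq_top_iff_one, Ideal.mem_span_singleton] at hI
    obtain ⟨⟨q, hq⟩, hq2⟩ := hI
    have hq3 : 1 = s * q := congrArg Subtype.val hq2
    have hq' : q ∈ Algebra.adjoin K {s} := hq
    rw [Algebra.adjoin_singleton_eq_range_aeval] at hq'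
    obtain ⟨w, hw⟩ := hq'
    have hw' : aeval s w = q := hw
    have h0 := (transcendental_iff.mp hst) (1 - X * w) (by simp [hw', ← hq3])
    have := congrArg (Polynomial.eval 0) h0
    simp at this
  obtain ⟨V, hAV, hIV⟩ := Ideal.image_subset_nonunits_valuationSubring I hI
  have hsV : s ∈ V := hAV hsA
  have hKV : ∀ x : K, algebraMap K Ω x ∈ V := fun x => hAV (A.algebraMap_mem x)
  have hsn : s ∈ V.nonunits := hIV ⟨⟨s, hsA⟩, Ideal.subset_span rfl, rfl⟩
  -- normalize
  have : Nonempty (Fin N) := ⟨i0⟩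
  obtain ⟨i, hi⟩ := Finite.exists_max (fun i => V.valuation (a i))
  have hai : a i ≠ 0 := by
    intro h0
    have := hi i0
    simp [h0, ha0] at this
  have hg1 := good_shear hHh (-(b i / a i)) hg
  have hg2 := good_scale_a hHh (a i)⁻¹ hg1
  set b' : Fin N → Ω := fun x => (a i)⁻¹ * (b x + -(b i / a i) * a x) with hb'
  have hb'i : b' i = 0 := by simp only [hb']; field_simp; ring
  obtain ⟨j, hj⟩ := Finite.exists_max (fun i => V.valuation (b' i))
  have hbj : b' j ≠ 0 := by
    intro h0
    have hall : ∀ x, b' x = 0 := by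
      intro x
      have := hj x
      simpa [h0] using this
    have h1 := hall i0
    simp only [hb', hb0, ha0] at h1
    have hbi : b i = 0 := by
      field_simp at h1
      simpa using h1
    have h2 := hall i1
    simp only [hb', hbi, hb1] at h2
    simp [hai] at h2
  have hg3 := good_scale_b (b' j)⁻¹ hg2
  have hij : i ≠ j := by rintro rfl; exact hbj hb'i
  have haV : ∀ x, (a i)⁻¹ * a x ∈ V := by
    intro x
    rw [← V.valuation_le_one_iff, map_mul, map_inv₀]
    have h0 : V.valuation (a i) ≠ 0 := by simpa using hai
    rw [inv_mul_le_iff₀ (zero_lt_iff.mpr h0), mul_one]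
    exact hi x
  have hbV : ∀ x, (b' j)⁻¹ * b' x ∈ V := by
    intro x
    rw [← V.valuation_le_one_iff, map_mul, map_inv₀]
    have h0 : V.valuation (b' j) ≠ 0 := by simpa using hbj
    rw [inv_mul_le_iff₀ (zero_lt_iff.mpr h0), mul_one]
    exact hj x
  let ι : K →+* V := (algebraMap K Ω).codRestrict V.toSubring hKV
  let av : Fin N → V := fun x => ⟨_, haV x⟩
  let bv : Fin N → V := fun x => ⟨_, hbV x⟩
  have hg4 : X ^ m ∣ LL (MvPolynomial.map ι F +
      MvPolynomial.C (⟨s, hsV⟩ : V) * MvPolynomial.map ι F0) av bv := by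
    apply good_of_inj (algebraMap V Ω) Subtype.val_injective
    have hc : (algebraMap V Ω).comp ι = algebraMap K Ω := by ext; rfl
    rw [map_add, map_mul, MvPolynomial.map_map, MvPolynomial.map_map, MvPolynomial.map_C, hc]
    exact hg3
  have hg5 := good_map (IsLocalRing.residue V) hg4
  have hres : IsLocalRing.residue V ⟨s, hsV⟩ = 0 := by
    rw [IsLocalRing.residue_eq_zero_iff]
    exact (V.mem_nonunits_iff_exists_mem_maximalIdeal.mp hsn).2
  rw [map_add, map_mul, MvPolynomial.map_C, hres, map_zero, zero_mul, add_zero,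
    MvPolynomial.map_map] at hg5
  let _ : Algebra K (IsLocalRing.ResidueField V) := ((IsLocalRing.residue V).comp ι).toAlgebra
  obtain ⟨B, φ, hBa, hBb, hfin⟩ := descend F _ _ hg5
  refine ⟨_, _, ?_, hfin⟩
  have e1 : av i = 1 := Subtype.ext (inv_mul_cancel₀ hai)
  have e2 : bv i = 0 := Subtype.ext (by simp [bv, hb'i])
  have e3 : bv j = 1 := Subtype.ext (inv_mul_cancel₀ hbj)
  have f1 : φ ⟨IsLocalRing.residue V (av i), hBa i⟩ = 1 := by
    rw [← map_one φ]; congr 1; exact Subtype.ext (by simp [e1])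
  have f2 : φ ⟨IsLocalRing.residue V (bv i), hBb i⟩ = 0 := by
    rw [← map_zero φ]; congr 1; exact Subtype.ext (by simp [e2])
  have f3 : φ ⟨IsLocalRing.residue V (bv j), hBb j⟩ = 1 := by
    rw [← map_one φ]; congr 1; exact Subtype.ext (by simp [e3])
  rw [LinearIndependent.pair_iff]
  intro x y hxy
  have g1 := congrFun hxy i
  have g2 := congrFun hxy j
  simp only [Pi.add_apply, Pi.smul_apply, smul_eq_mul, Pi.zero_apply] at g1 g2
  rw [f1, f2] at g1
  rw [f3] at g2
  have hx : x = 0 := by simpa using g1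
  refine ⟨hx, ?_⟩
  rw [hx] at g2
  simpa using g2

noncomputable def FF (K : Type*) [CommRing K] (n d m : ℕ) : MvPolynomial (Fin (n + 1)) K :=
  MvPolynomial.X (Fin.ofNat (n+1) 0) ^ (d - m) * MvPolynomial.X (Fin.ofNat (n+1) 1) ^ m +
  (∑ i ∈ Finset.range (m / 2), MvPolynomial.X (Fin.ofNat (n+1) (i + 2)) *
    MvPolynomial.X (Fin.ofNat (n+1) 1) ^ (2 * i) *
    MvPolynomial.X (Fin.ofNat (n+1) 0) ^ (d - 1 - 2 * i)) +
  if 2 ≤ m then MvPolynomial.X (Fin.ofNat (n+1) 2) *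
    MvPolynomial.X (Fin.ofNat (n+1) 1) ^ (m - 1) *
    MvPolynomial.X (Fin.ofNat (n+1) 0) ^ (d - m) else 0

theorem FF_hom (K : Type*) [CommRing K] (n d m : ℕ) (_hm : 1 ≤ m) (hmd : m ≤ d) :
    (FF K n d m).IsHomogeneous d := by
  have hx : ∀ i k, (MvPolynomial.X (R := K) (Fin.ofNat (n+1) i) ^ k).IsHomogeneous k :=
    fun i k => MvPolynomial.isHomogeneous_X_pow _ _
  have hx1 : ∀ i, (MvPolynomial.X (R := K) (Fin.ofNat (n+1) i)).IsHomogeneous 1 :=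
    fun i => MvPolynomial.isHomogeneous_X _ _
  unfold FF
  refine ((?_ : MvPolynomial.IsHomogeneous _ d).add ?_).add ?_
  · convert (hx 0 (d - m)).mul (hx 1 m) using 1
    omega
  · refine MvPolynomial.IsHomogeneous.sum _ _ _ fun i hi => ?_
    rw [Finset.mem_range] at hi
    convert ((hx1 (i+2)).mul (hx 1 (2*i))).mul (hx 0 (d - 1 - 2 * i)) using 1
    omega
  · split_ifs with h
    · convert ((hx1 2).mul (hx 1 (m-1))).mul (hx 0 (d - m)) using 1
      omega
    · exact MvPolynomial.isHomogeneous_zero _ _ _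

theorem FF_map {K L : Type*} [CommRing K] [CommRing L] (φ : K →+* L) (n d m : ℕ) :
    MvPolynomial.map φ (FF K n d m) = FF L n d m := by
  unfold FF
  split_ifs <;> simp

section
variable {R : Type*} [CommRing R]

def avec (n : ℕ) (v : ℕ → R) (e : R) : Fin (n + 1) → R := fun i =>
  if i.val = 0 then 1 else if i.val = 1 then e else
    v (2 * (i.val - 2)) + v (2 * (i.val - 2) + 1) * e

def bvec (n : ℕ) (v : ℕ → R) : Fin (n + 1) → R := fun i =>
  if i.val = 0 then 0 else if i.val = 1 then 1 else v (2 * (i.val - 2) + 1)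

noncomputable def gp (m : ℕ) (v : ℕ → R) : R[X] :=
  X ^ m + (∑ i ∈ Finset.range (m / 2), (C (v (2 * i)) + C (v (2 * i + 1)) * X) * X ^ (2 * i)) +
  if 2 ≤ m then (C (v 0) + C (v 1) * X) * X ^ (m - 1) else 0

theorem LL_FF (n d m : ℕ) (hn : 1 ≤ n) (hm2n : m ≤ 2 * n - 1) (v : ℕ → R) (e : R) :
    LL (FF R n d m) (avec n v e) (bvec n v) = (gp m v).comp (X + C e) := by
  have x0 : C (avec n v e (Fin.ofNat (n+1) 0)) + C (bvec n v (Fin.ofNat (n+1) 0)) * X = 1 := by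
    simp [avec, bvec]
  have x1 : C (avec n v e (Fin.ofNat (n+1) 1)) + C (bvec n v (Fin.ofNat (n+1) 1)) * X
      = X + C e := by
    have : 1 % (n + 1) = 1 := Nat.mod_eq_of_lt (by omega)
    simp [avec, bvec, this, add_comm]
  have x2 : ∀ i, i + 2 ≤ n → C (avec n v e (Fin.ofNat (n+1) (i+2))) +
      C (bvec n v (Fin.ofNat (n+1) (i+2))) * X = C (v (2 * i)) + C (v (2 * i + 1)) * (X + C e) := by
    intro i hi
    have : (i+2) % (n + 1) = i + 2 := Nat.mod_eq_of_lt (by omega)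
    simp [avec, bvec, this]
    ring
  unfold LL FF gp
  simp only [map_add, map_mul, map_pow, MvPolynomial.aeval_X, map_sum, x0, x1, one_pow, one_mul,
    mul_one, add_comp, X_comp, pow_comp]
  congr 1
  · congr 1
    rw [Polynomial.sum_comp]
    refine Finset.sum_congr rfl fun i hi => ?_
    rw [Finset.mem_range] at hi
    rw [x2 i (by omega)]
    simp
  · split_ifs with h
    · have := x2 0 (by omega)
      simp only [zero_add, mul_zero] at this
      simp only [map_mul, map_pow, MvPolynomial.aeval_X, x0, x1, this]
      simp
    · simp

theorem sum_pairs (v : ℕ → R) (k : ℕ) :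
    ∑ i ∈ Finset.range k, (C (v (2 * i)) + C (v (2 * i + 1)) * X) * X ^ (2 * i)
      = ∑ j ∈ Finset.range (2 * k), C (v j) * X ^ j := by
  induction k with
  | zero => simp
  | succ k ih =>
    rw [Finset.sum_range_succ, ih, Nat.mul_succ, Finset.sum_range_succ, Finset.sum_range_succ]
    ring

theorem gp_coeff (m : ℕ) (v : ℕ → R) (hv : ∀ j, m - 1 ≤ j → v j = 0) (j : ℕ) (hm : 1 ≤ m) :
    (gp m v).coeff j = (if j = m then 1 else 0) + v j +
      ((if j = m - 1 then v 0 else 0) + (if j = m then v 1 else 0)) := by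
  unfold gp
  rw [sum_pairs, coeff_add, coeff_add, coeff_X_pow, finsetSum_coeff]
  congr 1
  · congr 1
    simp only [coeff_C_mul, coeff_X_pow, mul_ite, mul_one, mul_zero]
    rw [Finset.sum_ite_eq]
    split_ifs with h
    · rfl
    · rw [hv]
      rw [Finset.mem_range] at h
      omega
  · split_ifs with h h1 h2 h2 h1 h2 h2
    all_goals try omega
    all_goals try (simp [hv 0 (by omega), hv 1 (by omega)])
    all_goals
      have hk : (C (v 0) + C (v 1) * X) * X ^ (m - 1) = C (v 0) * X ^ (m-1) + C (v 1) * X ^ m := by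
        obtain ⟨k, rfl⟩ : ∃ k, m = k + 1 := ⟨m - 1, by omega⟩
        simp only [Nat.add_sub_cancel]
        ring
      rw [hk]
      simp [coeff_X_pow, *]
    all_goals try omega

theorem isolated {K : Type*} [Field K] [IsDomain R] (π : R →+* K) (m : ℕ) (hm : 1 ≤ m)
    (v : ℕ → R) (e : R) (hv : ∀ j, m - 1 ≤ j → v j = 0) (hπv : ∀ j, π (v j) = 0)
    (hπe : π e = 0) (hinj : (m : K) = 0 → (m : R) = 0)
    (h : X ^ m ∣ (gp m v).comp (X + C e)) : e = 0 ∧ ∀ j, v j = 0 := by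
  obtain ⟨q, hq⟩ := h
  have hgdeg : (gp m v).natDegree ≤ m := by
    rw [natDegree_le_iff_coeff_eq_zero]
    intro j hj
    rw [gp_coeff m v hv j hm, hv j (by omega)]
    simp [show j ≠ m by omega, show j ≠ m - 1 by omega]
  have hqdeg : q.natDegree = 0 := by
    by_cases hq0 : q = 0
    · simp [hq0]
    have h1 : (X ^ m * q).natDegree = m + q.natDegree := by
      rw [natDegree_mul (by simp) hq0, natDegree_X_pow]
    rw [← hq, natDegree_comp, natDegree_X_add_C, mul_one] at h1
    omega
  obtain ⟨c, rfl⟩ : ∃ c, q = C c := ⟨_, eq_C_of_natDegree_eq_zero hqdeg⟩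
  have hg : gp m v = C c * (X - C e) ^ m := by
    have := congrArg (fun p => p.comp (X - C e)) hq
    simp only [comp_assoc, mul_comp, pow_comp, X_comp, C_comp, add_comp] at this
    simpa [mul_comm] using this
  have hco : ∀ j, (gp m v).coeff j = c * ((-e) ^ (m - j) * (m.choose j : R)) := by
    intro j
    rw [hg, coeff_C_mul, sub_eq_add_neg, ← C_neg, coeff_X_add_C_pow]
  have hcm := hco m
  rw [gp_coeff m v hv m hm, hv m (by omega)] at hcm
  simp [show m ≠ m - 1 by omega] at hcm
  have hc0 : c ≠ 0 := by
    intro h0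
    have := congrArg π hcm
    rw [h0] at this
    simp [hπv] at this
  have he : e = 0 := by
    by_contra hne
    rcases Nat.lt_or_ge m 2 with hm2 | hm2
    · have : m = 1 := by omega
      subst this
      have h0 := hco 0
      rw [gp_coeff 1 v hv 0 hm, hv 0 (by omega)] at h0
      simp [hne, hc0] at h0
    · have h0 := hco 0
      rw [gp_coeff m v hv 0 hm] at h0
      simp [show 0 ≠ m by omega, show 0 ≠ m - 1 by omega] at h0
      have h1 := hco (m - 1)
      rw [gp_coeff m v hv _ hm, hv (m - 1) le_rfl] at h1
      have h2 : m - (m - 1) = 1 := by omega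
      have h3 : m.choose (m - 1) = m := by
        rw [Nat.choose_symm_of_eq_add (show m = (m - 1) + 1 by omega), Nat.choose_one_right]
      simp [show m - 1 ≠ m by omega, h2, h3] at h1
      have h4 : (-e) ^ m = -e * m := mul_left_cancel₀ hc0 (by
        rw [← h0, h1]; ring)
      have h5 : (-e) ^ (m - 1) = m := by
        apply mul_left_cancel₀ (neg_ne_zero.mpr hne)
        rw [← h4, ← pow_succ']
        congr 1
        omega
      have h6 := congrArg π h5
      rw [map_pow, map_neg, hπe, neg_zero, zero_pow (by omega), map_natCast] at h6
      rw [hinj h6.symm] at h5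
      exact hne (by simpa using eq_zero_of_pow_eq_zero h5)
  refine ⟨he, fun j => ?_⟩
  by_cases hj : m - 1 ≤ j
  · exact hv j hj
  · have h0 := hco j
    rw [gp_coeff m v hv j hm, he, neg_zero, zero_pow (by omega)] at h0
    simpa [show j ≠ m by omega, show j ≠ m - 1 by omega] using h0
end

theorem stmt3 {K : Type*} [Field K] [IsAlgClosed K] (n d m : ℕ)
    (hn : 1 ≤ n) (hm1 : 1 ≤ m) (hmd : m ≤ d) (hm2n : m ≤ 2 * n - 1)
    (F : MvPolynomial (Fin (n + 1)) K) (hF : F.IsHomogeneous d) (hF0 : F ≠ 0) :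
    ∃ a b : Fin (n + 1) → K, LinearIndependent K ![a, b] ∧
      (Polynomial.X : Polynomial K) ^ m ∣
        MvPolynomial.aeval
          (fun i : Fin (n + 1) => Polynomial.C (a i) + Polynomial.C (b i) * Polynomial.X) F := by
  classical
  let R := MvPolynomial (Fin (m + 1)) K
  let v : ℕ → R := fun j => if h : j < m - 1 then MvPolynomial.X ⟨j, by omega⟩ else 0
  let e : R := MvPolynomial.X ⟨m - 1, by omega⟩
  let ε : R := MvPolynomial.X (Fin.last m)
  let m0 : Ideal R := RingHom.ker (MvPolynomial.constantCoeff (R := K) (σ := Fin (m + 1)))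
  have hm0 : m0.IsPrime := RingHom.ker_isPrime _
  have hht : ((m + 1 : ℕ) : ℕ∞) ≤ m0.height := height_vars K (m + 1)
  let G : MvPolynomial (Fin (n + 1)) R :=
    FF R n d m + MvPolynomial.C ε * MvPolynomial.map (algebraMap K R) F
  let Q : R[X] := LL G (avec n v e) (bvec n v)
  let T : Finset R := (Finset.range m).image Q.coeff
  let J : Ideal R := Ideal.span (T : Set R)
  have hcv : ∀ j, MvPolynomial.constantCoeff (v j) = 0 := by
    intro j
    by_cases h : j < m - 1 <;> simp [v, h]
  have hce : MvPolynomial.constantCoeff e = 0 := by simp [e]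
  have hcε : MvPolynomial.constantCoeff ε = 0 := by simp [ε]
  have hv0 : ∀ j, m - 1 ≤ j → v j = 0 := fun j hj => by simp [v, show ¬ j < m - 1 by omega]
  have LLsplit : Q = (gp m v).comp (X + C e) +
      C ε * LL (MvPolynomial.map (algebraMap K R) F) (avec n v e) (bvec n v) := by
    rw [← LL_FF n d m hn hm2n v e]
    simp only [Q, G, LL, map_add, map_mul]
    congr 2
    simp
  have hJ : J ≤ m0 := by
    rw [Ideal.span_le]
    intro x hx
    simp only [T, Finset.coe_image, Finset.coe_range, Set.mem_image, Set.mem_Iio] at hx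
    obtain ⟨j, hj, rfl⟩ := hx
    have h1 : Q.map (MvPolynomial.constantCoeff (R := K) (σ := Fin (m + 1))) = X ^ m := by
      rw [LLsplit]
      simp only [Polynomial.map_add, Polynomial.map_mul, Polynomial.map_C, hcε, Polynomial.map_comp,
        Polynomial.map_X, hce, map_zero, zero_mul, add_zero, comp_X]
      unfold gp
      split_ifs <;> simp [Polynomial.map_sum, hcv]
    have h2 := congrArg (fun p => p.coeff j) h1
    simp only [coeff_map, coeff_X_pow, show j ≠ m by omega, if_false] at h2
    exact h2
  obtain ⟨P, hP, hPm⟩ := Ideal.exists_minimalPrimes_le hJ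
  have hPp : P.IsPrime := hP.1.1
  have hPJ : J ≤ P := hP.1.2
  have hPh : P.height ≤ m := by
    refine (Ideal.height_le_card_of_mem_minimalPrimes_span_finset hP).trans ?_
    have : T.card ≤ m := Finset.card_image_le.trans (by simp)
    exact_mod_cast this
  have hne : P ≠ m0 := by
    rintro rfl
    have := hht.trans hPh
    have : m + 1 ≤ m := by exact_mod_cast this
    omega
  let mk := Ideal.Quotient.mk P
  let π : R ⧸ P →+* K := Ideal.Quotient.lift P MvPolynomial.constantCoeff (fun x hx => hPm hx)
  have hπ : ∀ x, π (mk x) = MvPolynomial.constantCoeff x := fun x => Ideal.Quotient.lift_mk _ _ _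
  have hgood : X ^ m ∣ Q.map mk := by
    rw [X_pow_dvd_iff]
    intro j hj
    rw [coeff_map]
    apply Ideal.Quotient.eq_zero_iff_mem.mpr
    apply hPJ
    apply Ideal.subset_span
    simp only [T, Finset.coe_image, Finset.coe_range, Set.mem_image, Set.mem_Iio]
    exact ⟨j, hj, rfl⟩
  have hεP : mk ε ≠ 0 := by
    intro h0
    apply hne
    refine le_antisymm hPm ?_
    have h1 : Q.map mk = (gp m (fun j => mk (v j))).comp (X + C (mk e)) := by
      rw [LLsplit]
      simp only [Polynomial.map_add, Polynomial.map_mul, Polynomial.map_C, h0, Polynomial.map_comp,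
        Polynomial.map_X, map_zero, zero_mul, add_zero]
      congr 1
      unfold gp
      split_ifs <;> simp [Polynomial.map_sum]
    rw [h1] at hgood
    obtain ⟨he, hv⟩ := isolated π m hm1 (fun j => mk (v j)) (mk e)
      (fun j hj => by simp [hv0 j hj]) (fun j => by rw [hπ, hcv]) (by rw [hπ, hce])
      (fun h => by
        have := congrArg (algebraMap K (R ⧸ P)) h
        simpa using this) hgood
    have hall : ∀ i : Fin (m + 1), (MvPolynomial.X i : R) ∈ P := by
      intro i
      rw [← Ideal.Quotient.eq_zero_iff_mem]
      rcases Nat.lt_or_ge i.val (m - 1) with hi | hi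
      · have := hv i.val
        simpa [v, hi] using this
      · rcases Nat.lt_or_ge i.val m with hi2 | hi2
        · have : i = ⟨m - 1, by omega⟩ := Fin.ext (by simp; omega)
          rw [this]; exact he
        · have : i = Fin.last m := Fin.ext (by simp; omega)
          rw [this]; exact h0
    intro x hx
    have hx0 : MvPolynomial.constantCoeff x = 0 := hx
    have h3 : mk = ((algebraMap K (R ⧸ P)).comp MvPolynomial.constantCoeff) := by
      apply MvPolynomial.ringHom_ext
      · intro r
        simp only [RingHom.comp_apply, MvPolynomial.constantCoeff_C]
        rfl
      · intro i
        simp only [RingHom.comp_apply, MvPolynomial.constantCoeff_X, map_zero]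
        exact Ideal.Quotient.eq_zero_iff_mem.mpr (hall i)
    rw [← Ideal.Quotient.eq_zero_iff_mem]
    change mk x = 0
    rw [h3, RingHom.comp_apply, hx0, map_zero]
  have hεt : Transcendental K (mk ε) := by
    rintro ⟨p, hp, hp0⟩
    obtain ⟨q, hq, hqd⟩ := Polynomial.exists_eq_pow_rootMultiplicity_mul_and_not_dvd p hp 0
    rw [hq] at hp0
    simp only [map_mul, map_pow, map_zero, sub_zero, aeval_X] at hp0
    have hq0 := (mul_eq_zero.mp hp0).resolve_left (pow_ne_zero _ hεP)
    apply hqd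
    rw [dvd_iff_isRoot, IsRoot]
    have h1 := congrArg π hq0
    rw [aeval_def, hom_eval₂, hπ, hcε, map_zero] at h1
    have h2 : π.comp (algebraMap K (R ⧸ P)) = RingHom.id K := by
      ext x
      change π (mk (MvPolynomial.C x)) = x
      rw [hπ, MvPolynomial.constantCoeff_C]
    rw [h2] at h1
    exact h1
  let Ω := FractionRing (R ⧸ P)
  let ψ : R →+* Ω := (algebraMap (R ⧸ P) Ω).comp mk
  have hinj : Function.Injective (algebraMap (R ⧸ P) Ω) := IsFractionRing.injective _ _
  have hψ : ψ.comp (algebraMap K R) = algebraMap K Ω := by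
    ext x
    rw [IsScalarTower.algebraMap_apply K (R ⧸ P) Ω]
    rfl
  have hgΩ : X ^ m ∣ Q.map ψ := by
    have := Polynomial.map_dvd (algebraMap (R ⧸ P) Ω) hgood
    rwa [Polynomial.map_map, Polynomial.map_pow, Polynomial.map_X] at this
  rw [LL_map] at hgΩ
  refine special F (FF K n d m) hF (FF_hom K n d m hm1 hmd) (ψ ε) ?_
    (fun i => ψ (avec n v e i)) (fun i => ψ (bvec n v i)) 0 (Fin.ofNat (n+1) 1) ?_ ?_ ?_ ?_
  · exact (transcendental_algebraMap_iff hinj).mpr hεt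
  · simp [avec]
  · simp [bvec]
  · have : 1 % (n + 1) = 1 := Nat.mod_eq_of_lt (by omega)
    simp [bvec, this]
  · rw [FF_map]
    simp only [G, map_add, map_mul, FF_map, MvPolynomial.map_C, MvPolynomial.map_map, hψ] at hgΩ
    exact hgΩ
end

section
/- Let K be a field, l, r positive integers with 3 ≤ l ≤ 2r. For a matrix B = (b_{i,j}) ∈ Mat(l, r; K), define the l × 2r matrix B̃ whose i-th row is (b_{i,1},…,b_{i,r}, b_{i-1,1},…,b_{i-1,r}) for 2 ≤ i ≤ l and whose first row is (b_{1,1},…,b_{1,r}, 0,…,0). Then the projectivized locus Δ(l,r) = {[B] ∈ P(Mat(l,r)) : rank B̃ < l} is Zariski closed of codimension min{r, 2r - l + 1} in P(Mat(l,r)). -/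
open PrimeSpectrum

/-- The `l × 2r` matrix `B̃` with generic entries: its `i`-th row is
`(b_{i,1},…,b_{i,r}, b_{i-1,1},…,b_{i-1,r})` (with the convention `b_{0,*} = 0`), where the
`b_{i,j}` are the coordinate functions on the space `Mat(l,r)`, i.e. the variables of the
polynomial ring `K[b_{i,j}]`. -/
noncomputable def genericBtilde (K : Type*) [Field K] (l r : ℕ) :
    Matrix (Fin l) (Fin (2 * r)) (MvPolynomial (Fin l × Fin r) K) :=
  Matrix.of fun i j =>
    if h : (j : ℕ) < r then MvPolynomial.X (i, ⟨j, h⟩)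
    else if h0 : (i : ℕ) = 0 then 0
    else MvPolynomial.X
      (⟨(i : ℕ) - 1, by omega⟩, ⟨(j : ℕ) - r, by have := j.isLt; omega⟩)

/-- The ideal of `K[b_{i,j}]` generated by all `l × l` minors of `B̃`; its zero locus is the
affine cone over `Δ(l,r) = {[B] : rank B̃ < l} ⊂ P(Mat(l,r))`. -/
noncomputable def minorsIdeal (K : Type*) [Field K] (l r : ℕ) :
    Ideal (MvPolynomial (Fin l × Fin r) K) :=
  Ideal.span {p | ∃ g : Fin l → Fin (2 * r), Function.Injective g ∧
    p = (((genericBtilde K l r).submatrix id g)).det}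



lemma aux_dim_le_of_integral {R S : Type*} [CommRing R] [CommRing S] [Algebra R S]
    [Algebra.IsIntegral R S] : ringKrullDim S ≤ ringKrullDim R := by
  refine Order.krullDim_le_of_strictMono (PrimeSpectrum.comap (algebraMap R S)) ?_
  intro p q h
  exact Ideal.IsIntegral.comap_lt_comap (R := R) (I := p.asIdeal) (J := q.asIdeal) h

lemma aux_le_dim_of_integral {R S : Type*} [CommRing R] [CommRing S] [Algebra R S]
    [Algebra.IsIntegral R S] (hinj : Function.Injective (algebraMap R S)) :
    ringKrullDim R ≤ ringKrullDim S := by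
  refine iSup_le fun p => ?_
  have : FaithfulSMul R S := (faithfulSMul_iff_algebraMap_injective R S).mpr hinj
  obtain ⟨Q, hQ⟩ := (Ideal.nonempty_primesOver (S := S) (RelSeries.head p).asIdeal)
  have := hQ.1
  have := hQ.2
  obtain ⟨L, hL, -, -⟩ := Ideal.exists_ltSeries_of_hasGoingUp (S := S) p Q
  rw [← hL]
  exact Order.LTSeries.length_le_krullDim L

universe u

lemma aux_upper {K A : Type u} [Field K] [CommRing A] [Algebra K A] [Algebra.FiniteType K A]
    [Nontrivial A] (n : ℕ)
    (h : ∀ Q : Ideal A, Q.IsPrime → Algebra.trdeg K (A ⧸ Q) ≤ n) : ringKrullDim A ≤ n := by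
  obtain ⟨s, g, hg, hint⟩ := exists_integral_inj_algHom_of_fg K A
  let : Algebra (MvPolynomial (Fin s) K) A := g.toRingHom.toAlgebra
  have : Algebra.IsIntegral (MvPolynomial (Fin s) K) A := ⟨hint⟩
  have : FaithfulSMul (MvPolynomial (Fin s) K) A :=
    (faithfulSMul_iff_algebraMap_injective _ _).mpr hg
  refine aux_dim_le_of_integral (R := MvPolynomial (Fin s) K).trans ?_
  rw [MvPolynomial.ringKrullDim_of_isNoetherianRing, ringKrullDim_eq_zero_of_field]
  obtain ⟨Q, hQ⟩ := (Ideal.nonempty_primesOver (S := A) (⊥ : Ideal (MvPolynomial (Fin s) K)))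
  have := hQ.1
  have h1 := h Q hQ.1
  have h2 : Algebra.trdeg K (MvPolynomial (Fin s) K) ≤ Algebra.trdeg K (A ⧸ Q) := by
    refine trdeg_le_of_injective ((Ideal.Quotient.mkₐ K Q).comp g) ?_
    rw [injective_iff_map_eq_zero]
    intro a ha
    have : a ∈ Q.under (MvPolynomial (Fin s) K) := by
      change g a ∈ Q
      exact Ideal.Quotient.eq_zero_iff_mem.mp ha
    rw [← hQ.2.over] at this
    simpa using this
  rw [MvPolynomial.trdeg_of_isDomain] at h2
  have h3 := h2.trans h1
  simp at h3
  simpa using h3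

lemma aux_lower {K A : Type u} [Field K] [CommRing A] [IsDomain A] [Algebra K A]
    [Algebra.FiniteType K A] (n : ℕ)
    (h : n ≤ Algebra.trdeg K A) : n ≤ ringKrullDim A := by
  obtain ⟨s, g, hg, hint⟩ := exists_integral_inj_algHom_of_fg K A
  let : Algebra (MvPolynomial (Fin s) K) A := g.toRingHom.toAlgebra
  have : Algebra.IsIntegral (MvPolynomial (Fin s) K) A := ⟨hint⟩
  have : FaithfulSMul (MvPolynomial (Fin s) K) A :=
    (faithfulSMul_iff_algebraMap_injective _ _).mpr hg
  have : IsScalarTower K (MvPolynomial (Fin s) K) A := IsScalarTower.of_algebraMap_eq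
    fun x => (g.commutes x).symm
  refine le_trans ?_ (aux_le_dim_of_integral (R := MvPolynomial (Fin s) K) hg)
  rw [MvPolynomial.ringKrullDim_of_isNoetherianRing, ringKrullDim_eq_zero_of_field]
  rw [← trdeg_add_eq K (MvPolynomial (Fin s) K) (A := A), trdeg_eq_zero (R := MvPolynomial (Fin s) K),
    MvPolynomial.trdeg_of_isDomain] at h
  simp at h
  simpa using h

lemma aux_top {R : Type*} [CommRing R] (I : Ideal R) :
    topologicalKrullDim (zeroLocus (I : Set R)) = ringKrullDim (R ⧸ I) := by
  rw [← PrimeSpectrum.topologicalKrullDim_eq_ringKrullDim]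
  have h := PrimeSpectrum.isClosedEmbedding_comap_of_surjective _ (Ideal.Quotient.mk I)
    Ideal.Quotient.mk_surjective
  have h2 := range_comap_of_surjective _ (Ideal.Quotient.mk I)
    Ideal.Quotient.mk_surjective
  rw [Ideal.mk_ker] at h2
  rw [← h2]
  exact (IsHomeomorph.topologicalKrullDim_eq _ h.isEmbedding.toHomeomorph.isHomeomorph).symm

/-- if all maximal minors vanish then rows are dependent -/
lemma aux_minors {L : Type*} [Field L] {l n : ℕ} (M : Matrix (Fin l) (Fin n) L)
    (h : ∀ g : Fin l → Fin n, Function.Injective g → (M.submatrix id g).det = 0) :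
    ∃ c : Fin l → L, c ≠ 0 ∧ Matrix.vecMul c M = 0 := by
  by_contra hc
  push Not at hc
  have hli : LinearIndependent L M.row := by
    rw [← Matrix.vecMul_injective_iff]
    change Function.Injective (Matrix.vecMulLinear M)
    rw [injective_iff_map_eq_zero (Matrix.vecMulLinear M)]
    intro a ha
    by_contra h0
    exact hc a h0 ha
  have hr : M.rank = l := by simpa using hli.rank_matrix
  rw [Matrix.rank_eq_finrank_span_cols] at hr
  obtain ⟨κ, a, ha, hspan, hlin⟩ := exists_linearIndependent' L M.col
  have : Finite κ := Finite.of_injective a ha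
  have := Fintype.ofFinite κ
  rw [← hspan, finrank_span_eq_card hlin] at hr
  let e : Fin l ≃ κ := (Fintype.equivFinOfCardEq hr).symm
  have hd := h (a ∘ e) (ha.comp e.injective)
  have h3 : LinearIndependent L (M.submatrix id (a ∘ e)).col := hlin.comp e e.injective
  rw [Matrix.linearIndependent_cols_iff_isUnit, Matrix.isUnit_iff_isUnit_det, hd] at h3
  simp at h3

def colL {r : ℕ} (j : Fin r) : Fin (2 * r) := ⟨j, by have := j.isLt; omega⟩
def colR {r : ℕ} (j : Fin r) : Fin (2 * r) := ⟨r + j, by have := j.isLt; omega⟩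

lemma col_cases {r : ℕ} (k : Fin (2 * r)) : (∃ j : Fin r, k = colL j) ∨ (∃ j : Fin r, k = colR j) := by
  by_cases h : (k : ℕ) < r
  · exact Or.inl ⟨⟨k, h⟩, rfl⟩
  · refine Or.inr ⟨⟨k - r, by have := k.isLt; omega⟩, ?_⟩
    ext
    simp [colR]
    omega

lemma gB_left (K : Type*) [Field K] (l r : ℕ) (i : Fin l) (j : Fin r) :
    genericBtilde K l r i (colL j) = MvPolynomial.X (i, j) := by
  simp [genericBtilde, colL]

lemma gB_zero (K : Type*) [Field K] (m r : ℕ) (j : Fin r) :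
    genericBtilde K (m + 1) r 0 (colR j) = 0 := by
  simp [genericBtilde, colR]

lemma gB_succ (K : Type*) [Field K] (m r : ℕ) (i : Fin m) (j : Fin r) :
    genericBtilde K (m + 1) r i.succ (colR j) = MvPolynomial.X (i.castSucc, j) := by
  simp [genericBtilde, colR]
  rfl

lemma vecMul_gB {K : Type*} [Field K] {m r : ℕ} {L : Type*} [CommRing L]
    (f : MvPolynomial (Fin (m + 1) × Fin r) K →+* L) (c : Fin (m + 1) → L) :
    Matrix.vecMul c ((genericBtilde K (m + 1) r).map f) = 0 ↔
      (∀ j, ∑ i, c i * f (MvPolynomial.X (i, j)) = 0) ∧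
      (∀ j, ∑ i : Fin m, c i.succ * f (MvPolynomial.X (i.castSucc, j)) = 0) := by
  have hL : ∀ j, Matrix.vecMul c ((genericBtilde K (m + 1) r).map f) (colL j) =
      ∑ i, c i * f (MvPolynomial.X (i, j)) := by
    intro j
    simp [Matrix.vecMul, dotProduct, gB_left]
  have hR : ∀ j, Matrix.vecMul c ((genericBtilde K (m + 1) r).map f) (colR j) =
      ∑ i : Fin m, c i.succ * f (MvPolynomial.X (i.castSucc, j)) := by
    intro j
    simp [Matrix.vecMul, dotProduct, Fin.sum_univ_succ, gB_zero, gB_succ]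
  constructor
  · intro h
    exact ⟨fun j => by rw [← hL, h]; rfl, fun j => by rw [← hR, h]; rfl⟩
  · rintro ⟨h1, h2⟩
    funext k
    rcases col_cases k with ⟨j, rfl⟩ | ⟨j, rfl⟩
    · rw [hL, h1]; rfl
    · rw [hR, h2]; rfl

lemma minors_le_ker {K : Type*} [Field K] {m r : ℕ} {L : Type*} [CommRing L] [IsDomain L]
    (f : MvPolynomial (Fin (m + 1) × Fin r) K →+* L) (c : Fin (m + 1) → L) (hc : c ≠ 0)
    (h : Matrix.vecMul c ((genericBtilde K (m + 1) r).map f) = 0) :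
    minorsIdeal K (m + 1) r ≤ RingHom.ker f := by
  rw [minorsIdeal, Ideal.span_le]
  rintro p ⟨g, -, rfl⟩
  rw [SetLike.mem_coe, RingHom.mem_ker, RingHom.map_det, ← Matrix.exists_vecMul_eq_zero_iff]
  refine ⟨c, hc, ?_⟩
  funext k
  exact congrFun h (g k)

lemma exists_vec {K : Type*} [Field K] {l r : ℕ} {L : Type*} [Field L]
    (f : MvPolynomial (Fin l × Fin r) K →+* L) (hf : minorsIdeal K l r ≤ RingHom.ker f) :
    ∃ c : Fin l → L, c ≠ 0 ∧ Matrix.vecMul c ((genericBtilde K l r).map f) = 0 := by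
  refine aux_minors _ fun g hg => ?_
  have : ((genericBtilde K l r).submatrix id g).det ∈ RingHom.ker f :=
    hf (Ideal.subset_span ⟨g, hg, rfl⟩)
  rw [RingHom.mem_ker, RingHom.map_det] at this
  exact this

/-- the field-theoretic bound -/
lemma trdeg_bound {K L : Type u} [Field K] [Field L] [Algebra K L] {m r n : ℕ}
    (b : Fin (m + 1) → Fin r → L) (c : Fin (m + 1) → L) (hc : c ≠ 0)
    (h1 : ∀ j, ∑ i, c i * b i j = 0)
    (h2 : ∀ j, ∑ i : Fin m, c i.succ * b i.castSucc j = 0)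
    (hb : ∀ S : Subalgebra K L, (∀ i j, b i j ∈ S) → Algebra.IsAlgebraic S L)
    (hn1 : m * r ≤ n) (hn2 : m + (m - 1) * r ≤ n) : Algebra.trdeg K L ≤ n := by
  classical
  suffices h : ∃ T : Finset L, T.card ≤ n ∧ ∀ i j, b i j ∈ Algebra.adjoin K (T : Set L) by
    obtain ⟨T, hT, h⟩ := h
    have := hb _ h
    refine (Algebra.IsAlgebraic.trdeg_le_cardinalMk K (T : Set L)).trans ?_
    simpa using hT
  have hex : (Finset.univ.filter fun i => c i ≠ 0).Nonempty := by
    obtain ⟨i, hi⟩ := Function.ne_iff.mp hc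
    exact ⟨i, by simpa using hi⟩
  obtain ⟨k, hk, hmax⟩ := Finset.exists_max_image _ (id : Fin (m + 1) → Fin (m + 1)) hex
  have hck : c k ≠ 0 := by simpa using hk
  have hmax' : ∀ i, k < i → c i = 0 := by
    intro i hi
    by_contra h0
    exact absurd (hmax i (by simpa using h0)) (not_le.mpr hi)
  clear hmax hk hex
  -- normalise
  wlog hck1 : c k = 1 generalizing c
  · refine this (fun i => (c k)⁻¹ * c i) ?_ ?_ ?_ ?_ ?_ ?_
    · exact Function.ne_iff.mpr ⟨k, by simp [hck]⟩
    · intro j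
      simp only [mul_assoc, ← Finset.mul_sum, h1, mul_zero]
    · intro j
      simp only [mul_assoc, ← Finset.mul_sum, h2, mul_zero]
    · simp [hck]
    · intro i hi
      simp [hmax' i hi]
    · simp [hck]
  induction k using Fin.cases with
  | zero =>
    refine ⟨((Finset.univ : Finset (Fin m × Fin r))).image (fun p => b p.1.succ p.2), ?_, ?_⟩
    · refine Finset.card_image_le.trans ?_
      simpa using hn1
    · intro i j
      induction i using Fin.cases with
      | zero =>
        have := h1 j
        rw [Fin.sum_univ_succ] at this
        simp only [hck1, hmax' _ (Fin.succ_pos _)] at this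
        have h0 : b 0 j = 0 := by simpa using this
        rw [h0]; exact zero_mem _
      | succ i =>
        apply Algebra.subset_adjoin
        simp only [Finset.coe_image, Finset.coe_univ, Set.image_univ]
        exact ⟨(i, j), rfl⟩
  | succ k =>
    set T1 : Finset L := (Finset.univ.erase k.succ).image c with hT1
    set T2 : Finset L := (((Finset.univ.erase k.succ).erase k.castSucc) ×ˢ
      (Finset.univ : Finset (Fin r))).image (fun p => b p.1 p.2) with hT2
    have hne : k.castSucc ≠ k.succ := (Fin.castSucc_lt_succ).ne
    refine ⟨T1 ∪ T2, ?_, ?_⟩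
    · refine (Finset.card_union_le _ _).trans (le_trans (add_le_add Finset.card_image_le
        Finset.card_image_le) ?_)
      rw [Finset.card_product, Finset.card_erase_of_mem (Finset.mem_erase.mpr ⟨hne, Finset.mem_univ _⟩),
        Finset.card_erase_of_mem (by simp)]
      simpa using hn2
    · have hcm : ∀ i, i ≠ k.succ → c i ∈ Algebra.adjoin K ((T1 ∪ T2 : Finset L) : Set L) := by
        intro i hi
        apply Algebra.subset_adjoin
        simp only [Finset.coe_union]
        left
        exact Finset.mem_coe.mpr (Finset.mem_image_of_mem _ (by simp [hi]))
      have hbm : ∀ i j, i ≠ k.succ → i ≠ k.castSucc →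
          b i j ∈ Algebra.adjoin K ((T1 ∪ T2 : Finset L) : Set L) := by
        intro i j hi hi'
        apply Algebra.subset_adjoin
        simp only [Finset.coe_union]
        right
        exact Finset.mem_coe.mpr (Finset.mem_image.mpr ⟨(i, j), by simp [hi, hi'], rfl⟩)
      have hb1 : ∀ j, b k.castSucc j ∈ Algebra.adjoin K ((T1 ∪ T2 : Finset L) : Set L) := by
        intro j
        have := h2 j
        rw [← Finset.add_sum_erase _ _ (Finset.mem_univ k), hck1, one_mul] at this
        rw [eq_neg_of_add_eq_zero_left this]
        refine neg_mem (sum_mem fun i hi => ?_)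
        have hik : i ≠ k := Finset.ne_of_mem_erase hi
        rcases lt_or_gt_of_ne hik with hlt | hgt
        · refine mul_mem (hcm _ (by simpa using hik)) (hbm _ _ ?_ (by simpa using hik))
          exact (lt_trans (Fin.castSucc_lt_castSucc_iff.mpr hlt) (Fin.castSucc_lt_succ)).ne
        · rw [hmax' _ (Fin.succ_lt_succ_iff.mpr hgt), zero_mul]
          exact zero_mem _
      have hb2 : ∀ j, b k.succ j ∈ Algebra.adjoin K ((T1 ∪ T2 : Finset L) : Set L) := by
        intro j
        have := h1 j
        rw [← Finset.add_sum_erase _ _ (Finset.mem_univ k.succ), hck1, one_mul] at this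
        rw [eq_neg_of_add_eq_zero_left this]
        refine neg_mem (sum_mem fun i hi => ?_)
        have hik := Finset.ne_of_mem_erase hi
        refine mul_mem (hcm _ hik) ?_
        by_cases h' : i = k.castSucc
        · rw [h']; exact hb1 j
        · exact hbm _ _ hik h'
      intro i j
      by_cases h : i = k.succ
      · rw [h]; exact hb2 j
      · by_cases h' : i = k.castSucc
        · rw [h']; exact hb1 j
        · exact hbm _ _ h h'

lemma upper_bound (K : Type u) [Field K] (m r n : ℕ)
    (hne : minorsIdeal K (m + 1) r ≠ ⊤)
    (hn1 : m * r ≤ n) (hn2 : m + (m - 1) * r ≤ n) :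
    ringKrullDim (MvPolynomial (Fin (m + 1) × Fin r) K ⧸ minorsIdeal K (m + 1) r) ≤ n := by
  have : Nontrivial (MvPolynomial (Fin (m + 1) × Fin r) K ⧸ minorsIdeal K (m + 1) r) :=
    Ideal.Quotient.nontrivial_iff.mpr hne
  refine aux_upper (K := K) n fun Q hQ => ?_
  set D := (MvPolynomial (Fin (m + 1) × Fin r) K ⧸ minorsIdeal K (m + 1) r) ⧸ Q
  let L := FractionRing D
  refine (trdeg_le_of_injective (IsScalarTower.toAlgHom K D L)
    (IsFractionRing.injective D L)).trans ?_
  let π : MvPolynomial (Fin (m + 1) × Fin r) K →ₐ[K] D :=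
    (Ideal.Quotient.mkₐ K Q).comp (Ideal.Quotient.mkₐ K _)
  have hπ : Function.Surjective π :=
    (Ideal.Quotient.mkₐ_surjective K Q).comp (Ideal.Quotient.mkₐ_surjective K _)
  let f : MvPolynomial (Fin (m + 1) × Fin r) K →ₐ[K] L := (IsScalarTower.toAlgHom K D L).comp π
  have hf : minorsIdeal K (m + 1) r ≤ RingHom.ker f.toRingHom := by
    intro x hx
    rw [RingHom.mem_ker]
    change algebraMap D L (Ideal.Quotient.mk Q (Ideal.Quotient.mk _ x)) = 0
    rw [Ideal.Quotient.eq_zero_iff_mem.mpr hx, map_zero, map_zero]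
  obtain ⟨c, hc, hcv⟩ := exists_vec f.toRingHom hf
  obtain ⟨h1, h2⟩ := (vecMul_gB _ _).mp hcv
  refine trdeg_bound (fun i j => f (MvPolynomial.X (i, j))) c hc h1 h2 ?_ hn1 hn2
  intro S hS
  have hr : f.range ≤ S := by
    rw [← Algebra.map_top, ← MvPolynomial.adjoin_range_X, AlgHom.map_adjoin, Algebra.adjoin_le_iff]
    rintro _ ⟨_, ⟨⟨i, j⟩, rfl⟩, rfl⟩
    exact hS i j
  refine ⟨fun x => ?_⟩
  obtain ⟨a, b, hb, rfl⟩ := IsFractionRing.div_surjective (A := D) x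
  obtain ⟨a, rfl⟩ := hπ a
  obtain ⟨b, rfl⟩ := hπ b
  have ha' : IsAlgebraic S (algebraMap D L (π a)) :=
    isAlgebraic_algebraMap (⟨f a, hr ⟨a, rfl⟩⟩ : S)
  have hb' : IsAlgebraic S (algebraMap D L (π b)) :=
    isAlgebraic_algebraMap (⟨f b, hr ⟨b, rfl⟩⟩ : S)
  rw [div_eq_mul_inv]
  exact ha'.mul hb'.inv

lemma lower_a (K : Type u) [Field K] (m r : ℕ) :
    ((m * r : ℕ) : WithBot ℕ∞) ≤
      ringKrullDim (MvPolynomial (Fin (m + 1) × Fin r) K ⧸ minorsIdeal K (m + 1) r) := by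
  let f : MvPolynomial (Fin (m + 1) × Fin r) K →ₐ[K] MvPolynomial (Fin m × Fin r) K :=
    MvPolynomial.aeval fun p => Fin.cases 0 (fun i => MvPolynomial.X (i, p.2)) p.1
  have hker : minorsIdeal K (m + 1) r ≤ RingHom.ker f.toRingHom := by
    refine minors_le_ker _ (Pi.single 0 1) (by simp) ?_
    rw [vecMul_gB]
    constructor
    · intro j
      simp [Fin.sum_univ_succ, f]
    · intro j
      simp
  have hs : Function.Surjective f := by
    rw [← AlgHom.range_eq_top, eq_top_iff, ← MvPolynomial.adjoin_range_X, Algebra.adjoin_le_iff]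
    rintro _ ⟨⟨i, j⟩, rfl⟩
    exact ⟨MvPolynomial.X (i.succ, j), by simp [f]⟩
  have h := ringKrullDim_le_of_surjective (Ideal.Quotient.lift (minorsIdeal K (m + 1) r)
    f.toRingHom (fun a ha => hker ha)) (Ideal.Quotient.lift_surjective_of_surjective _ _ hs)
  rw [MvPolynomial.ringKrullDim_of_isNoetherianRing, ringKrullDim_eq_zero_of_field] at h
  simpa using h

section family

variable (K : Type u) [Field K] (m r : ℕ)

abbrev FamRing := MvPolynomial (Fin (m + 1) ⊕ Fin m × Fin r) K

noncomputable def famC : Fin (m + 1) → FamRing K m r := fun i => MvPolynomial.X (Sum.inl i)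

noncomputable def famB1 (i : Fin (m + 1)) (j : Fin r) : FamRing K m r :=
  Fin.lastCases (motive := fun _ => FamRing K m r)
    (-∑ s : Fin m, famC K m r s.succ * MvPolynomial.X (Sum.inr (s, j)))
    (fun s : Fin m => MvPolynomial.X (Sum.inr (s, j))) i

noncomputable def famB (i : Fin (m + 2)) (j : Fin r) : FamRing K m r :=
  Fin.lastCases (motive := fun _ => FamRing K m r)
    (-∑ s : Fin (m + 1), famC K m r s * famB1 K m r s j)
    (fun s : Fin (m + 1) => famB1 K m r s j) i

noncomputable def famCC (i : Fin (m + 2)) : FamRing K m r :=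
  Fin.lastCases (motive := fun _ => FamRing K m r) 1 (famC K m r) i

noncomputable def famφ : MvPolynomial (Fin (m + 2) × Fin r) K →ₐ[K] FamRing K m r :=
  MvPolynomial.aeval fun p => famB K m r p.1 p.2

lemma famφ_X (i : Fin (m + 2)) (j : Fin r) :
    famφ K m r (MvPolynomial.X (i, j)) = famB K m r i j := by
  simp [famφ]

lemma fam_vecMul :
    Matrix.vecMul (famCC K m r) ((genericBtilde K (m + 2) r).map (famφ K m r).toRingHom) = 0 := by
  rw [vecMul_gB]
  constructor
  · intro j
    change ∑ i, famCC K m r i * famφ K m r (MvPolynomial.X (i, j)) = 0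
    simp only [famφ_X]
    rw [Fin.sum_univ_castSucc]
    simp [famCC, famB]
  · intro j
    change ∑ i : Fin (m + 1), famCC K m r i.succ * famφ K m r (MvPolynomial.X (i.castSucc, j)) = 0
    simp only [famφ_X]
    rw [Fin.sum_univ_castSucc]
    have hcs : ∀ s : Fin m, famCC K m r s.castSucc.succ = famC K m r s.succ := by
      intro s
      rw [Fin.succ_castSucc, famCC, Fin.lastCases_castSucc]
    have hcl : famCC K m r (Fin.last m).succ = 1 := by
      rw [Fin.succ_last, famCC, Fin.lastCases_last]
    simp only [hcs, hcl]
    simp [famB, famB1]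

lemma famCC_ne : famCC K m r ≠ 0 :=
  Function.ne_iff.mpr ⟨Fin.last _, by simp [famCC]⟩

noncomputable def famψ : FamRing K m r →ₐ[K] K :=
  MvPolynomial.aeval (Sum.elim (fun _ => 0)
    (fun p => if (p.1 : ℕ) = min (2 * (p.2 : ℕ)) (m - 1) then 1 else 0))

lemma famψ_B (hm : 1 ≤ m) (i : Fin (m + 2)) (j : Fin r) :
    famψ K m r (famB K m r i j) = if (i : ℕ) = min (2 * (j : ℕ)) (m - 1) then 1 else 0 := by
  induction i using Fin.lastCases with
  | last =>
    rw [if_neg (by simp; omega)]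
    simp [famB, famC, famψ]
  | cast i =>
    induction i using Fin.lastCases with
    | last =>
      rw [if_neg (by simp; omega)]
      simp [famB, famB1, famC, famψ]
    | cast i =>
      simp [famB, famB1, famψ]

def famg (hr : m + 2 ≤ 2 * r) (k : Fin (m + 1)) : Fin (2 * r) :=
  if (k : ℕ) % 2 = 0 ∧ (k : ℕ) < m then colL ⟨k / 2, by have := k.isLt; omega⟩
  else colR ⟨k / 2, by have := k.isLt; omega⟩

lemma fam_entry (hm : 1 ≤ m) (hr : m + 2 ≤ 2 * r) (k k' : Fin (m + 1)) :
    famψ K m r (famφ K m r (genericBtilde K (m + 2) r k.castSucc (famg m r hr k'))) =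
      (1 : Matrix (Fin (m + 1)) (Fin (m + 1)) K) k k' := by
  rw [Matrix.one_apply]
  have hk' := k'.isLt
  by_cases h : (k' : ℕ) % 2 = 0 ∧ (k' : ℕ) < m
  · rw [famg, if_pos h, gB_left, famφ_X, famψ_B K m r hm]
    congr 1
    rw [Fin.ext_iff]
    simp only [Fin.val_castSucc, eq_iff_iff]
    omega
  · rw [famg, if_neg h]
    induction k using Fin.cases with
    | zero =>
      rw [Fin.castSucc_zero, gB_zero, map_zero, map_zero, if_neg]
      rw [Fin.ext_iff]
      simp only [Fin.val_zero]
      omega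
    | succ s =>
      rw [← Fin.succ_castSucc, gB_succ, famφ_X, famψ_B K m r hm]
      congr 1
      rw [Fin.ext_iff]
      simp only [Fin.val_castSucc, Fin.val_succ, eq_iff_iff]
      omega

lemma fam_algebraic (hm : 1 ≤ m) (hr : m + 2 ≤ 2 * r) :
    Algebra.IsAlgebraic (famφ K m r).range (FamRing K m r) := by
  set S := (famφ K m r).range with hS
  -- matrices over `S`
  let MS : Matrix (Fin (m + 2)) (Fin (2 * r)) S :=
    (genericBtilde K (m + 2) r).map (famφ K m r).rangeRestrict
  let N : Matrix (Fin (m + 1)) (Fin (m + 1)) S := MS.submatrix Fin.castSucc (famg m r hr)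
  let w : Fin (m + 1) → S := fun k => MS (Fin.last _) (famg m r hr k)
  have hdet : N.det ≠ 0 := by
    intro h0
    have h1 : ((famψ K m r).comp S.val).toRingHom N.det = 1 := by
      rw [RingHom.map_det]
      have hone : ((famψ K m r).comp S.val).toRingHom.mapMatrix N = 1 := by
        ext k k'
        exact fam_entry K m r hm hr k k'
      rw [hone, Matrix.det_one]
    rw [h0, map_zero] at h1
    exact zero_ne_one h1
  let ι : S →+* FamRing K m r := algebraMap S (FamRing K m r)
  have hv : Matrix.vecMul (famC K m r) (N.map ι) = - fun k => ι (w k) := by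
    funext k
    have := congrFun (fam_vecMul K m r) (famg m r hr k)
    rw [Matrix.vecMul, dotProduct, Fin.sum_univ_castSucc] at this
    simp only [famCC, Fin.lastCases_castSucc, Fin.lastCases_last, one_mul] at this
    exact eq_neg_of_add_eq_zero_left this
  have hc : ∀ k, ι N.det * famC K m r k = ι (Matrix.vecMul (-w) N.adjugate k) := by
    intro k
    have h2 := congrArg (fun v => Matrix.vecMul v (N.adjugate.map ι) k) hv
    simp only [Matrix.vecMul_vecMul] at h2
    rw [← Matrix.map_mul, Matrix.mul_adjugate] at h2
    have h3 : (N.det • (1 : Matrix (Fin (m + 1)) (Fin (m + 1)) S)).map ι =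
      (ι N.det) • (1 : Matrix (Fin (m + 1)) (Fin (m + 1)) (FamRing K m r)) := by
      ext a b
      by_cases hab : a = b <;> simp [hab]
    rw [h3, Matrix.vecMul_smul, Matrix.vecMul_one] at h2
    refine h2.trans ?_
    simp [Matrix.vecMul, dotProduct]
  have hι : Function.Injective ι := Subtype.val_injective
  have hX : ∀ x : Fin (m + 1) ⊕ Fin m × Fin r,
      IsAlgebraic S (MvPolynomial.X x : FamRing K m r) := by
    rintro (k | ⟨i, j⟩)
    · refine ⟨Polynomial.C N.det * Polynomial.X - Polynomial.C (Matrix.vecMul (-w) N.adjugate k),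
        ?_, ?_⟩
      · intro h0
        have := congrArg (fun p => Polynomial.coeff p 1) h0
        simp [Polynomial.coeff_C] at this
        exact hdet this
      · have := hc k
        simp only [map_sub, map_mul, Polynomial.aeval_C, Polynomial.aeval_X]
        exact sub_eq_zero.mpr this
    · have : (MvPolynomial.X (Sum.inr (i, j)) : FamRing K m r) ∈ S := by
        refine ⟨MvPolynomial.X (i.castSucc.castSucc, j), ?_⟩
        change famφ K m r _ = _
        rw [famφ_X]
        simp [famB, famB1]
      exact isAlgebraic_algebraMap (⟨_, this⟩ : S)
  refine ⟨fun p => ?_⟩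
  induction p using MvPolynomial.induction_on with
  | C a =>
    exact isAlgebraic_algebraMap (algebraMap K S a)
  | add p q hp hq => exact hp.add hq
  | mul_X p x hp => exact hp.mul (hX x)

lemma lower_b (hm : 1 ≤ m) (hr : m + 2 ≤ 2 * r) :
    ((m + 1 + m * r : ℕ) : WithBot ℕ∞) ≤
      ringKrullDim (MvPolynomial (Fin (m + 2) × Fin r) K ⧸ minorsIdeal K (m + 2) r) := by
  have hker : minorsIdeal K (m + 2) r ≤ RingHom.ker (famφ K m r).rangeRestrict.toRingHom := by
    intro x hx
    have h := minors_le_ker (famφ K m r).toRingHom _ (famCC_ne K m r) (fam_vecMul K m r) hx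
    rw [RingHom.mem_ker] at h ⊢
    exact Subtype.ext h
  have h := ringKrullDim_le_of_surjective (Ideal.Quotient.lift (minorsIdeal K (m + 2) r)
    (famφ K m r).rangeRestrict.toRingHom (fun a ha => hker ha))
    (Ideal.Quotient.lift_surjective_of_surjective _ _ (famφ K m r).rangeRestrict_surjective)
  refine le_trans ?_ h
  have hft : Algebra.FiniteType K (famφ K m r).range :=
    Algebra.FiniteType.of_surjective (famφ K m r).rangeRestrict
      (famφ K m r).rangeRestrict_surjective
  refine aux_lower (K := K) _ ?_
  have halg := fam_algebraic K m r hm hr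
  have h2 := trdeg_add_eq K (famφ K m r).range (A := FamRing K m r)
  rw [trdeg_eq_zero (R := (famφ K m r).range), add_zero, MvPolynomial.trdeg_of_isDomain] at h2
  rw [h2]
  simp

end family

lemma aux_main (K : Type u) [Field K] (l r : ℕ) (hl : 3 ≤ l) (hlr : l ≤ 2 * r) :
    ringKrullDim (MvPolynomial (Fin l × Fin r) K ⧸ minorsIdeal K l r) =
      ((l * r - min r (2 * r - l + 1) : ℕ) : WithBot ℕ∞) := by
  obtain ⟨m, rfl⟩ : ∃ m, l = m + 2 := ⟨l - 2, by omega⟩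
  have ha := lower_a K (m + 1) r
  have hb := lower_b K m r (by omega) hlr
  have e1 : (m + 2) * r = m * r + 2 * r := by ring
  have e2 : (m + 1) * r = m * r + r := by ring
  apply le_antisymm
  · refine upper_bound K (m + 1) r _ ?_ (by omega) ?_
    · intro h
      rw [h] at ha
      have : Subsingleton (MvPolynomial (Fin (m + 1 + 1) × Fin r) K ⧸
        (⊤ : Ideal (MvPolynomial (Fin (m + 1 + 1) × Fin r) K))) :=
        Ideal.Quotient.subsingleton_iff.mpr rfl
      rw [ringKrullDim_eq_bot_of_subsingleton] at ha
      exact absurd ha (not_le.mpr (WithBot.bot_lt_coe _))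
    · simp only [Nat.add_sub_cancel]
      omega
  · rcases le_total r (2 * r - (m + 2) + 1) with h | h
    · rw [min_eq_left h]
      refine le_trans (le_of_eq ?_) ha
      congr 2
      omega
    · rw [min_eq_right h]
      refine le_trans (le_of_eq ?_) hb
      congr 2
      omega
/-- **Lemma on `Δ(l,r)`.** For `3 ≤ l ≤ 2r`, the locus
`Δ(l,r) = {[B] ∈ P(Mat(l,r)) : rank B̃ < l}` is Zariski closed of codimension
`min {r, 2r - l + 1}` in `P(Mat(l,r))`; equivalently, its affine cone — the zero locus of the
ideal of `l×l` minors of the generic matrix `B̃` — is Zariski closed of dimension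
`l·r - min {r, 2r - l + 1}` in the `l·r`-dimensional affine space `Mat(l,r)`. -/
theorem stmt4 (K : Type*) [Field K] (l r : ℕ) (hl : 3 ≤ l) (hlr : l ≤ 2 * r) :
    IsClosed (zeroLocus (R := MvPolynomial (Fin l × Fin r) K) ↑(minorsIdeal K l r)) ∧
      topologicalKrullDim
          (zeroLocus (R := MvPolynomial (Fin l × Fin r) K) ↑(minorsIdeal K l r)) =
        ((l * r - min r (2 * r - l + 1) : ℕ) : WithBot ℕ∞) := by
  exact ⟨isClosed_zeroLocus _, (aux_top _).trans (aux_main K l r hl hlr)⟩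
end

section
/- Let K be a field, 3 ≤ l ≤ 2r. With B̃ as above, the locus Δ⁰(l,r) = {[B] ∈ P(Mat(l,r)) : rank B̃ < l and the first row (b_{1,1},…,b_{1,r}) ≠ 0} is locally closed of codimension exactly 2r - l + 1 in P(Mat(l,r)). -/
open PrimeSpectrum

/-- The ideal generated by the first-row variables `b_{1,1}, …, b_{1,r}`; its zero locus is the
locus where the first row of `B` vanishes. -/
noncomputable def firstRowIdeal (K : Type*) [Field K] (l r : ℕ) [NeZero l] :
    Ideal (MvPolynomial (Fin l × Fin r) K) :=
  Ideal.span {p | ∃ j : Fin r, p = MvPolynomial.X ((0 : Fin l), j)}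


lemma topDim_eq_krullDim_aux {R : Type*} [CommRing R] (V W : Set (PrimeSpectrum R))
    (hV : IsClosed V) (hW : IsClosed W) :
    topologicalKrullDim (V \ W : Set (PrimeSpectrum R)) =
      Order.krullDim (V \ W : Set (PrimeSpectrum R)) := by
  have h1 : QuasiSober (Wᶜ : Set (PrimeSpectrum R)) :=
    (hW.isOpen_compl.isOpenEmbedding_subtypeVal).quasiSober
  have h2 : QuasiSober (V \ W : Set (PrimeSpectrum R)) :=
    @QuasiSober.inter_of_isClosed_of_quasiSober_right _ _ Wᶜ V h1 hV
  let e : (V \ W : Set (PrimeSpectrum R)) ≃o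
      (TopologicalSpace.IrreducibleCloseds (V \ W : Set (PrimeSpectrum R)))ᵒᵈ :=
    { __ := irreducibleSetEquivPoints.toEquiv.symm.trans OrderDual.toDual
      map_rel_iff' := fun {p q} => (RelIso.symm irreducibleSetEquivPoints).map_rel_iff.trans
        ((subtype_specializes_iff p q).trans (le_iff_specializes p.1 q.1).symm) }
  rw [Order.krullDim_eq_of_orderIso e, Order.krullDim_orderDual]
  rfl

lemma coheight_le_aux {R : Type*} [CommRing R] (X : Set (PrimeSpectrum R)) (n : ℕ)
    (h : ∀ p ∈ X, ringKrullDim (R ⧸ p.asIdeal) ≤ n) : Order.krullDim X ≤ n := by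
  refine iSup_le fun c => ?_
  have h0 := h c.head.1 c.head.2
  rw [ringKrullDim_quotient] at h0
  let c' : LTSeries (zeroLocus (R := R) c.head.1.asIdeal) :=
    { length := c.length
      toFun := fun i => ⟨(c i).1, by
        have : c.head ≤ c i := c.head_le i
        exact this⟩
      step := fun i => c.step i }
  exact (Order.LTSeries.length_le_krullDim c').trans h0

lemma le_dim_aux {R : Type*} [CommRing R] [IsNoetherianRing R] (X : Set (PrimeSpectrum R))
    (s : Finset R) (m : PrimeSpectrum R) (n c : ℕ) (hs : (s : Set R) ⊆ m.asIdeal)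
    (hX : ∀ q : PrimeSpectrum R, (s : Set R) ⊆ q.asIdeal → q ≤ m → q ∈ X)
    (hc : s.card ≤ c) (hn : ((n + c : ℕ) : ℕ∞) ≤ m.asIdeal.height) :
    (n : WithBot ℕ∞) ≤ Order.krullDim X := by
  have h1 := Ideal.height_le_height_add_encard_of_subset (s : Set R) hs
  have hpr : (m.asIdeal.map (Ideal.Quotient.mk (Ideal.span (s : Set R)))).IsPrime :=
    Ideal.isPrime_map_quotientMk_of_isPrime (Ideal.span_le.2 hs)
  have h2 : (n : ℕ∞) ≤ (m.asIdeal.map (Ideal.Quotient.mk (Ideal.span (s : Set R)))).height := by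
    rw [Set.encard_coe_eq_coe_finsetCard] at h1
    have h3 : ((n + c : ℕ) : ℕ∞) ≤
        (m.asIdeal.map (Ideal.Quotient.mk (Ideal.span (s : Set R)))).height + (c : ℕ) :=
      hn.trans (h1.trans (by gcongr))
    push_cast at h3
    exact (ENat.add_le_add_iff_right (ENat.natCast_ne_top c)).1 h3
  have h3 := PrimeSpectrum.height_eq_orderHeight
    (⟨_, hpr⟩ : PrimeSpectrum (R ⧸ Ideal.span (s : Set R)))
  simp only at h3
  rw [h3] at h2
  obtain ⟨p, hp, hpl⟩ := Order.exists_series_of_le_height _ h2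
  let f := PrimeSpectrum.comap (Ideal.Quotient.mk (Ideal.span (s : Set R)))
  have hsurj : Function.Surjective (Ideal.Quotient.mk (Ideal.span (s : Set R))) :=
    Ideal.Quotient.mk_surjective
  have hf : ∀ i, f (p i) ∈ X := by
    intro i
    apply hX
    · intro x hx
      change Ideal.Quotient.mk (Ideal.span (s : Set R)) x ∈ (p i).asIdeal
      rw [Ideal.Quotient.eq_zero_iff_mem.2 (Ideal.subset_span hx)]
      exact zero_mem _
    · have : p i ≤ p.last := LTSeries.monotone p (Fin.le_last i)
      rw [hp] at this
      have h5 : (f (p i)).asIdeal ≤ m.asIdeal := by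
        refine (Ideal.comap_mono (show (p i).asIdeal ≤ _ from this)).trans ?_
        rw [Ideal.comap_map_of_surjective _ hsurj]
        rw [← RingHom.ker_eq_comap_bot, Ideal.mk_ker]
        exact sup_le le_rfl (Ideal.span_le.2 hs)
      exact h5
  let c' : LTSeries X :=
    { length := p.length
      toFun := fun i => ⟨f (p i), hf i⟩
      step := fun i => by
        have h6 : p i.castSucc < p i.succ := p.step i
        have : f (p i.castSucc) < f (p i.succ) := by
          refine lt_of_le_not_ge (Ideal.comap_mono (show (p i.castSucc).asIdeal ≤ _ from h6.le)) ?_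
          intro h7
          apply h6.not_ge
          exact (Ideal.comap_le_comap_iff_of_surjective _ hsurj _ _).1 h7
        exact this }
  have := Order.LTSeries.length_le_krullDim c'
  rwa [show c'.length = n from hpl] at this

lemma height_ker_aux {K σ : Type*} [Field K] [Fintype σ] (a : σ → K) :
    (Fintype.card σ : ℕ∞) ≤ (RingHom.ker (MvPolynomial.eval a)).height := by
  classical
  let φ : Finset σ → (MvPolynomial σ K →+* MvPolynomial σ K) := fun S =>
    (MvPolynomial.bind₁ (fun i => if i ∈ S then MvPolynomial.C (a i) else MvPolynomial.X i) :
      MvPolynomial σ K →ₐ[K] MvPolynomial σ K)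
  have hφ : ∀ S i, φ S (MvPolynomial.X i) =
    if i ∈ S then MvPolynomial.C (a i) else MvPolynomial.X i := fun S i => by simp [φ]
  have hφC : ∀ S x, φ S (MvPolynomial.C x) = MvPolynomial.C x := fun S x => by simp [φ]
  have key : ∀ S : Finset σ, (S.card : ℕ∞) ≤ (RingHom.ker (φ S)).height := by
    intro S
    induction S using Finset.induction_on with
    | empty => simp
    | insert i S hi ih =>
      have hp1 : (RingHom.ker (φ S)).IsPrime := RingHom.ker_isPrime _
      have hp2 : (RingHom.ker (φ (insert i S))).IsPrime := RingHom.ker_isPrime _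
      have hlt : RingHom.ker (φ S) < RingHom.ker (φ (insert i S)) := by
        have hcomp : φ (insert i S) = (φ (insert i S)).comp (φ S) := by
          apply MvPolynomial.ringHom_ext
          · intro r; simp [hφC]
          · intro j
            simp only [RingHom.comp_apply, hφ]
            by_cases hj : j ∈ S
            · simp [hj, hφC]
            · simp [hj, hφ]
        refine lt_of_le_of_ne ?_ ?_
        · intro x hx
          rw [RingHom.mem_ker] at hx ⊢
          rw [hcomp, RingHom.comp_apply, hx, map_zero]
        · intro heq
          have : (MvPolynomial.X i - MvPolynomial.C (a i)) ∈ RingHom.ker (φ S) := by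
            rw [heq, RingHom.mem_ker]
            simp [hφ, hφC]
          rw [RingHom.mem_ker] at this
          simp only [map_sub, hφ, hφC, hi, if_false] at this
          have h2 := congrArg (MvPolynomial.eval (fun _ => a i + 1)) this
          simp at h2
      rw [Finset.card_insert_of_notMem hi]
      push_cast
      refine (add_le_add_left ih 1).trans ?_
      exact Ideal.height_add_one_le_of_lt_of_isPrime hlt
  have := key Finset.univ
  rw [Finset.card_univ] at this
  refine this.trans (Ideal.height_mono ?_)
  intro x hx
  rw [RingHom.mem_ker] at hx ⊢
  have h : MvPolynomial.eval a = (MvPolynomial.eval a).comp (φ Finset.univ) := by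
    apply MvPolynomial.ringHom_ext
    · intro r; simp [hφC]
    · intro j; simp [hφ]
  rw [h, RingHom.comp_apply, hx, map_zero]

lemma dim_le_aux.{u} {K A L : Type u} [Field K] [CommRing A] [IsDomain A] [Algebra K A]
    [Algebra.FiniteType K A] [Field L] [Algebra A L] [Algebra K L] [IsScalarTower K A L]
    [IsFractionRing A L] {ι : Type} [Fintype ι] (x : ι → L)
    (h : ∀ a : A, algebraMap A L a ∈ Algebra.adjoin K (Set.range x)) :
    ringKrullDim A ≤ (Fintype.card ι : ℕ) := by
  obtain ⟨s, g, hg, hfin⟩ := exists_finite_inj_algHom_of_fg K A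
  have hint : g.toRingHom.IsIntegral := hfin.to_isIntegral
  have h1 : ringKrullDim A ≤ ringKrullDim (MvPolynomial (Fin s) K) := by
    refine Order.krullDim_le_of_strictMono (PrimeSpectrum.comap g.toRingHom) ?_
    intro p q hpq
    algebraize [g.toRingHom]
    have : Algebra.IsIntegral (MvPolynomial (Fin s) K) A := ⟨hint⟩
    exact Ideal.IsIntegral.comap_lt_comap hpq
  have h2 : ringKrullDim (MvPolynomial (Fin s) K) = (s : ℕ) := by
    rw [MvPolynomial.ringKrullDim_of_isNoetherianRing]
    simp
  rw [h2] at h1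
  refine h1.trans ?_
  have h3 : Algebra.IsAlgebraic (Algebra.adjoin K (Set.range x)) L := by
    constructor
    intro y
    obtain ⟨a, b, hb, rfl⟩ := IsFractionRing.div_surjective (A := A) y
    have e : ∀ a : A, IsAlgebraic (Algebra.adjoin K (Set.range x)) (algebraMap A L a) := fun a =>
      isAlgebraic_algebraMap (⟨_, h a⟩ : Algebra.adjoin K (Set.range x))
    rw [div_eq_mul_inv]
    exact (e a).mul (e b).inv
  have h4 := Algebra.IsAlgebraic.trdeg_le_cardinalMk K (Set.range x)
  have h5 : AlgebraicIndependent K (fun i => algebraMap A L (g (MvPolynomial.X i))) := by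
    have : AlgebraicIndependent K (fun i => g (MvPolynomial.X i)) :=
      (MvPolynomial.algebraicIndependent_X (Fin s) K).map' hg
    exact this.map' (f := IsScalarTower.toAlgHom K A L) (IsFractionRing.injective A L)
  have h6 := h5.lift_cardinalMk_le_trdeg
  have h7 : Cardinal.mk (Set.range x) ≤ (Fintype.card ι : ℕ) := by
    have := Cardinal.mk_range_le_lift (f := x)
    simpa using this
  have h8 : ((s : ℕ) : Cardinal.{u}) ≤ (Fintype.card ι : ℕ) := by
    refine le_trans ?_ (h4.trans h7)
    simpa using h6
  exact_mod_cast h8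

lemma exists_ker_aux {L : Type*} [Field L] {l : ℕ} {n : Type*} [Fintype n]
    (M : Matrix (Fin l) n L)
    (h : ∀ g : Fin l → n, Function.Injective g → (M.submatrix id g).det = 0) :
    ∃ v : Fin l → L, v ≠ 0 ∧ Matrix.vecMul v M = 0 := by
  by_contra hcon
  push Not at hcon
  have hinj : Function.Injective fun v => Matrix.vecMul v M := by
    intro v w hvw
    by_contra hne
    refine hcon (v - w) (sub_ne_zero.2 hne) ?_
    rw [Matrix.sub_vecMul]
    exact sub_eq_zero.2 hvw
  have hr := (Matrix.vecMul_injective_iff.1 hinj).rank_matrix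
  rw [Matrix.rank_eq_finrank_span_cols, Fintype.card_fin] at hr
  obtain ⟨f, hf, -, hli⟩ := Submodule.exists_fun_fin_finrank_span_eq L (Set.range M.col)
  choose g hg using hf
  let g' : Fin l → n := fun i => g (Fin.cast hr.symm i)
  have hli' : LinearIndependent L (M.submatrix id g').col := by
    have : (M.submatrix id g').col = f ∘ (Fin.cast hr.symm) := by
      funext i
      exact hg _
    rw [this]
    exact hli.comp _ (Fin.cast_injective _)
  have hg' : Function.Injective g' := by
    intro i j hij
    apply hli'.injective
    funext k
    simp [Matrix.col, hij]
  have hu := Matrix.linearIndependent_cols_iff_isUnit.1 hli'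
  rw [Matrix.isUnit_iff_isUnit_det, h g' hg'] at hu
  exact not_isUnit_zero hu

lemma bordered_aux {A : Type*} [CommRing A] [IsDomain A] {t : ℕ} {n : Type*}
    (M : Matrix (Fin (t + 1)) n A) (g0 : Fin t → n)
    (h0 : (M.submatrix Fin.castSucc g0).det ≠ 0)
    (h : ∀ j, (M.submatrix id (Fin.snoc g0 j : Fin (t + 1) → n)).det = 0) (g : Fin (t + 1) → n) :
    (M.submatrix id g).det = 0 := by
  let w : Fin (t + 1) → A := fun i =>
    (-1) ^ ((i : ℕ) + t) * (M.submatrix i.succAbove g0).det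
  have hw : ∀ j, ∑ i, w i * M i j = 0 := by
    intro j
    rw [← h j, Matrix.det_succ_column _ (Fin.last t)]
    refine Finset.sum_congr rfl fun i _ => ?_
    have : (M.submatrix id (Fin.snoc g0 j : Fin (t + 1) → n)).submatrix i.succAbove
        (Fin.last t).succAbove = M.submatrix i.succAbove g0 := by
      ext a b
      simp
    rw [this]
    simp [w]
    ring
  rw [← Matrix.exists_vecMul_eq_zero_iff]
  refine ⟨w, ?_, ?_⟩
  · intro hz
    apply h0
    have := congrFun hz (Fin.last t)
    simpa [w] using this
  · funext j
    exact hw (g j)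

lemma adjoin_aux {K L : Type*} [Field K] [Field L] [Algebra K L] {l r : ℕ}
    (b : Fin l → Fin r → L) (u : Fin l → L) (k : Fin l) (hk : u k = 1) (hk0 : (k : ℕ) ≠ 0)
    (hgt : ∀ i, k < i → u i = 0)
    (h1 : ∀ j, ∑ i, u i * b i j = 0)
    (h2 : ∀ j, ∑ i : Fin l, u i *
      (if (i : ℕ) = 0 then 0 else b ⟨(i : ℕ) - 1, by omega⟩ j) = 0)
    (T : Subalgebra K L) (hu : ∀ i, u i ∈ T)
    (hb : ∀ i : Fin l, i ≠ k → (i : ℕ) + 1 ≠ k → ∀ j, b i j ∈ T) (i : Fin l) (j : Fin r) :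
    b i j ∈ T := by
  have hk1 : ∀ i : Fin l, (i : ℕ) + 1 = k → b i j ∈ T := by
    intro i hi
    have h := h2 j
    rw [← Finset.add_sum_erase _ _ (Finset.mem_univ k)] at h
    simp only [hk, if_neg hk0, one_mul] at h
    have e : (⟨(k : ℕ) - 1, by omega⟩ : Fin l) = i := by ext; simp; omega
    rw [e] at h
    rw [eq_neg_of_add_eq_zero_left h]
    refine neg_mem (sum_mem fun a ha => ?_)
    have hak : a ≠ k := Finset.ne_of_mem_erase ha
    rcases lt_or_gt_of_ne hak with hlt | hlt
    · refine mul_mem (hu a) ?_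
      split_ifs with h0
      · exact zero_mem _
      · have : (a : ℕ) < k := hlt
        apply hb
        · intro hh
          have := congrArg Fin.val hh
          simp at this
          omega
        · simp; omega
    · rw [hgt a hlt, zero_mul]; exact zero_mem _
  have hlt' : ∀ i : Fin l, i ≠ k → b i j ∈ T := by
    intro i hi
    by_cases h : (i : ℕ) + 1 = k
    · exact hk1 i h
    · exact hb i hi h j
  by_cases hik : i = k
  · subst hik
    have h := h1 j
    rw [← Finset.add_sum_erase _ _ (Finset.mem_univ i)] at h
    simp only [hk, one_mul] at h
    rw [eq_neg_of_add_eq_zero_left h]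
    refine neg_mem (sum_mem fun a ha => ?_)
    exact mul_mem (hu a) (hlt' a (Finset.ne_of_mem_erase ha))
  · exact hlt' i hik

lemma genericBtilde_left {K : Type*} [Field K] {l r : ℕ} (i : Fin l) (j : Fin (2 * r)) (j' : Fin r)
    (h : (j : ℕ) = j') : genericBtilde K l r i j = MvPolynomial.X (i, j') := by
  have h' : (j : ℕ) < r := by omega
  have : (⟨(j : ℕ), h'⟩ : Fin r) = j' := by ext; exact h
  simp [genericBtilde, h', this]

lemma genericBtilde_right {K : Type*} [Field K] {l r : ℕ} (i : Fin l) (j : Fin (2 * r))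
    (j' : Fin r) (h : (j : ℕ) = r + j') : genericBtilde K l r i j =
      if (i : ℕ) = 0 then 0 else MvPolynomial.X (⟨(i : ℕ) - 1, by omega⟩, j') := by
  have h' : ¬ (j : ℕ) < r := by omega
  have : (⟨(j : ℕ) - r, by omega⟩ : Fin r) = j' := by ext; simp; omega
  simp [genericBtilde, h', this]

lemma upper_aux (K : Type*) [Field K] (l r : ℕ) (hl : 3 ≤ l) [NeZero l]
    (p : PrimeSpectrum (MvPolynomial (Fin l × Fin r) K))
    (h1 : p ∈ zeroLocus (R := MvPolynomial (Fin l × Fin r) K) ↑(minorsIdeal K l r))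
    (h2 : p ∉ zeroLocus (R := MvPolynomial (Fin l × Fin r) K) ↑(firstRowIdeal K l r)) :
    ringKrullDim (MvPolynomial (Fin l × Fin r) K ⧸ p.asIdeal) ≤
      (((l - 1) + (l - 2) * r : ℕ) : WithBot ℕ∞) := by
  classical
  let A := MvPolynomial (Fin l × Fin r) K ⧸ p.asIdeal
  let L := FractionRing A
  let φ : MvPolynomial (Fin l × Fin r) K →ₐ[K] L :=
    (IsScalarTower.toAlgHom K A L).comp (Ideal.Quotient.mkₐ K p.asIdeal)
  have hφ : ∀ x, φ x = 0 ↔ x ∈ p.asIdeal := by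
    intro x
    have : φ x = algebraMap A L (Ideal.Quotient.mk p.asIdeal x) := rfl
    rw [this, ← Ideal.Quotient.eq_zero_iff_mem]
    exact IsFractionRing.to_map_eq_zero_iff
  let b : Fin l → Fin r → L := fun i j => φ (MvPolynomial.X (i, j))
  obtain ⟨v, hv0, hv⟩ := exists_ker_aux ((genericBtilde K l r).map φ) (by
    intro g hg
    have : φ ((genericBtilde K l r).submatrix id g).det = 0 := by
      rw [hφ]
      exact h1 (Ideal.subset_span ⟨g, hg, rfl⟩)
    rw [AlgHom.map_det] at this
    exact this)
  have e1 : ∀ j, ∑ i, v i * b i j = 0 := by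
    intro j
    have := congrFun hv (⟨j, by omega⟩ : Fin (2 * r))
    refine Eq.trans ?_ this
    refine Finset.sum_congr rfl fun i _ => ?_
    simp only [Matrix.map_apply]
    rw [genericBtilde_left i _ j rfl]
  have e2 : ∀ j, ∑ i : Fin l, v i *
      (if (i : ℕ) = 0 then 0 else b ⟨(i : ℕ) - 1, by omega⟩ j) = 0 := by
    intro j
    have := congrFun hv (⟨r + j, by omega⟩ : Fin (2 * r))
    refine Eq.trans ?_ this
    refine Finset.sum_congr rfl fun i _ => ?_
    simp only [Matrix.map_apply]
    rw [genericBtilde_right i _ j rfl]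
    split_ifs <;> simp [b]
  obtain ⟨j0, hj0⟩ : ∃ j, b 0 j ≠ 0 := by
    by_contra hcon
    push Not at hcon
    apply h2
    refine (mem_zeroLocus _ _).2 ?_
    rw [SetLike.coe_subset_coe, firstRowIdeal, Ideal.span_le]
    rintro _ ⟨j, rfl⟩
    exact (hφ _).1 (hcon j)
  -- last nonzero index
  have hne : (Finset.univ.filter fun i => v i ≠ 0).Nonempty := by
    obtain ⟨i, hi⟩ := Function.ne_iff.1 hv0
    exact ⟨i, by simpa using hi⟩
  let k := (Finset.univ.filter fun i => v i ≠ 0).max' hne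
  have hk : v k ≠ 0 := by simpa using (Finset.max'_mem _ hne)
  have hkgt : ∀ i, k < i → v i = 0 := by
    intro i hi
    by_contra hvi
    have := Finset.le_max' (Finset.univ.filter fun i => v i ≠ 0) i (by simpa using hvi)
    exact absurd hi (not_lt.2 this)
  have hk0 : (k : ℕ) ≠ 0 := by
    intro hk0
    have hk0' : k = 0 := by ext; simpa using hk0
    have h := e1 j0
    rw [Finset.sum_eq_single k] at h
    · rw [hk0'] at h
      rcases mul_eq_zero.1 h with h | h
      · exact hk (hk0' ▸ h)
      · exact hj0 h
    · intro i _ hi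
      rw [hkgt i, zero_mul]
      refine lt_of_le_of_ne ?_ (Ne.symm hi)
      rw [Fin.le_def]; omega
    · simp
  let u : Fin l → L := fun i => v i / v k
  let km : Fin l := ⟨(k : ℕ) - 1, by omega⟩
  let ι := {i : Fin l // i ≠ k} ⊕ ({i : Fin l // i ∉ ({k, km} : Finset (Fin l))} × Fin r)
  let x : ι → L := Sum.elim (fun i => u i) (fun q => b q.1 q.2)
  have hT := adjoin_aux (K := K) b u k (div_self hk) hk0 (fun i hi => by simp [u, hkgt i hi])
    (fun j => by
      have := congrArg (fun z => z / v k) (e1 j)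
      simp only [zero_div] at this
      refine Eq.trans ?_ this
      rw [Finset.sum_div]
      refine Finset.sum_congr rfl fun i _ => ?_
      simp only [u]; ring)
    (fun j => by
      have := congrArg (fun z => z / v k) (e2 j)
      simp only [zero_div] at this
      refine Eq.trans ?_ this
      rw [Finset.sum_div]
      refine Finset.sum_congr rfl fun i _ => ?_
      simp only [u]; ring)
    (Algebra.adjoin K (Set.range x))
    (fun i => by
      by_cases hi : i = k
      · have : u i = 1 := by rw [hi]; exact div_self hk
        rw [this]; exact one_mem _
      · exact Algebra.subset_adjoin ⟨Sum.inl ⟨i, hi⟩, rfl⟩)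
    (fun i hi hi' j => Algebra.subset_adjoin ⟨Sum.inr (⟨i, by
      simp only [Finset.mem_insert, Finset.mem_singleton, not_or]
      refine ⟨hi, fun h => hi' ?_⟩
      rw [h]; simp [km]; omega⟩, j), rfl⟩)
  have hcard : Fintype.card ι = (l - 1) + (l - 2) * r := by
    have hkm : k ≠ km := by
      intro h
      have := congrArg Fin.val h
      simp [km] at this
      omega
    simp only [ι, Fintype.card_sum, Fintype.card_prod, Fintype.card_fin]
    rw [Fintype.card_subtype_compl, Fintype.card_subtype_compl, Fintype.card_coe,
      Finset.card_pair hkm]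
    simp
  rw [← hcard]
  refine dim_le_aux (K := K) (A := A) (L := L) x ?_
  intro a
  obtain ⟨q, rfl⟩ := Ideal.Quotient.mk_surjective a
  change φ q ∈ _
  induction q using MvPolynomial.induction_on with
  | C c =>
    have : φ (MvPolynomial.C c) = algebraMap K L c := φ.commutes c
    rw [this]; exact Subalgebra.algebraMap_mem _ c
  | add p q hp hq => rw [map_add]; exact add_mem hp hq
  | mul_X p i hp => rw [map_mul]; exact mul_mem hp (hT i.1 i.2)

def pt (K : Type*) [Field K] (t r : ℕ) : Fin (t + 1) × Fin r → K := fun q =>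
  if ((q.1 : ℕ) % 2 = 0 ∧ (q.1 : ℕ) + 2 ≤ t ∧ (q.2 : ℕ) = (q.1 : ℕ) / 2) ∨
    ((q.1 : ℕ) + 2 = t ∧ (q.2 : ℕ) = ((q.1 : ℕ) + 1) / 2) then 1 else 0

def colsel (t r : ℕ) (h : t + 1 ≤ 2 * r) : Fin t → Fin (2 * r) := fun i =>
  if (i : ℕ) % 2 = 1 ∨ (i : ℕ) + 1 = t then ⟨r + (i : ℕ) / 2, by omega⟩
  else ⟨(i : ℕ) / 2, by omega⟩

lemma eval_colsel (K : Type*) [Field K] (t r : ℕ) (ht : 2 ≤ t) (h : t + 1 ≤ 2 * r) :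
    ((genericBtilde K (t + 1) r).map (MvPolynomial.eval (pt K t r))).submatrix Fin.castSucc
      (colsel t r h) = 1 := by
  ext i i'
  simp only [Matrix.submatrix_apply, Matrix.map_apply, Matrix.one_apply]
  by_cases hc : (i' : ℕ) % 2 = 1 ∨ (i' : ℕ) + 1 = t
  · rw [genericBtilde_right _ _ ⟨(i' : ℕ) / 2, by omega⟩ (by simp [colsel, hc])]
    simp only [Fin.val_castSucc]
    split_ifs with h1 h2 h2
    · exfalso; subst h2; omega
    · simp
    · subst h2
      simp only [MvPolynomial.eval_X, pt]
      rw [if_pos]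
      omega
    · have h2' : (i : ℕ) ≠ i' := fun h => h2 (Fin.ext h)
      simp only [MvPolynomial.eval_X, pt]
      rw [if_neg]
      omega
  · rw [genericBtilde_left _ _ ⟨(i' : ℕ) / 2, by omega⟩ (by simp [colsel, hc])]
    simp only [MvPolynomial.eval_X, pt, Fin.val_castSucc]
    by_cases h2 : i = i'
    · subst h2
      rw [if_pos rfl, if_pos]
      omega
    · have h2' : (i : ℕ) ≠ i' := fun h => h2 (Fin.ext h)
      rw [if_neg h2, if_neg]
      omega

lemma eval_last (K : Type*) [Field K] (t r : ℕ) (ht : 2 ≤ t) (j : Fin (2 * r)) :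
    MvPolynomial.eval (pt K t r) (genericBtilde K (t + 1) r (Fin.last t) j) = 0 := by
  by_cases hj : (j : ℕ) < r
  · rw [genericBtilde_left _ _ ⟨j, hj⟩ rfl]
    simp only [MvPolynomial.eval_X, pt, Fin.val_last]
    rw [if_neg]; omega
  · rw [genericBtilde_right _ _ ⟨j - r, by omega⟩ (by simp; omega)]
    simp only [Fin.val_last]
    rw [if_neg (by omega)]
    simp only [MvPolynomial.eval_X, pt]
    rw [if_neg]; omega

lemma lower_aux (K : Type*) [Field K] (t r : ℕ) (ht : 2 ≤ t) (htr : t + 1 ≤ 2 * r)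
    [NeZero (t + 1)] (n : ℕ) (hn : n + (2 * r - t) = (t + 1) * r) :
    (n : WithBot ℕ∞) ≤ Order.krullDim
      ((zeroLocus (R := MvPolynomial (Fin (t + 1) × Fin r) K) ↑(minorsIdeal K (t + 1) r) \
            zeroLocus ↑(firstRowIdeal K (t + 1) r) : Set _)) := by
  classical
  let B := genericBtilde K (t + 1) r
  let g0 := colsel t r htr
  let f : Fin (2 * r) → MvPolynomial (Fin (t + 1) × Fin r) K := fun j =>
    (B.submatrix id (Fin.snoc g0 j : Fin (t + 1) → Fin (2 * r))).det
  have hg0 : Function.Injective g0 := by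
    intro i j hij
    by_contra hne
    have h1 := congrFun (congrFun (eval_colsel K t r ht htr) i) i
    have h2 := congrFun (congrFun (eval_colsel K t r ht htr) i) j
    simp only [Matrix.submatrix_apply, Matrix.one_apply] at h1 h2
    rw [show colsel t r htr i = colsel t r htr j from hij, h2] at h1
    simp [hne] at h1
  let s := ((Finset.univ \ Finset.univ.image g0).image f)
  let m : PrimeSpectrum (MvPolynomial (Fin (t + 1) × Fin r) K) :=
    ⟨RingHom.ker (MvPolynomial.eval (pt K t r)), RingHom.ker_isPrime _⟩
  refine le_dim_aux _ s m n (2 * r - t) ?_ ?_ ?_ ?_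
  · intro x hx
    simp only [s, Finset.coe_image, Set.mem_image] at hx
    obtain ⟨j, -, rfl⟩ := hx
    change f j ∈ RingHom.ker (MvPolynomial.eval (pt K t r))
    rw [RingHom.mem_ker, RingHom.map_det]
    apply Matrix.det_eq_zero_of_row_eq_zero (Fin.last t)
    intro j'
    exact eval_last K t r ht _
  · intro q hsq hqm
    let π := Ideal.Quotient.mk q.asIdeal
    constructor
    · refine (mem_zeroLocus _ _).2 ?_
      rw [SetLike.coe_subset_coe, minorsIdeal, Ideal.span_le]
      rintro _ ⟨g, -, rfl⟩
      change _ ∈ q.asIdeal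
      rw [← Ideal.Quotient.eq_zero_iff_mem, RingHom.map_det]
      refine bordered_aux (B.map π) g0 ?_ ?_ g
      · have : ((B.map π).submatrix Fin.castSucc g0).det =
          π (B.submatrix Fin.castSucc g0).det := by
          rw [RingHom.map_det]; rfl
        rw [this]
        intro hz
        have h1 := hqm (Ideal.Quotient.eq_zero_iff_mem.1 hz)
        change _ ∈ RingHom.ker (MvPolynomial.eval (pt K t r)) at h1
        rw [RingHom.mem_ker, RingHom.map_det] at h1
        have h2 := congrArg Matrix.det (eval_colsel K t r ht htr)
        rw [Matrix.det_one] at h2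
        exact one_ne_zero (h2.symm.trans h1)
      · intro j
        have : ((B.map π).submatrix id (Fin.snoc g0 j : Fin (t + 1) → Fin (2 * r))).det =
          π (f j) := by
          rw [RingHom.map_det]; rfl
        rw [this]
        by_cases hj : ∃ i, g0 i = j
        · obtain ⟨i, hi⟩ := hj
          have : f j = 0 := by
            refine Matrix.det_zero_of_column_eq (i := i.castSucc) (j := Fin.last t)
              (Fin.castSucc_lt_last i).ne ?_
            intro a
            simp [hi]
          rw [this, map_zero]
        · apply Ideal.Quotient.eq_zero_iff_mem.2
          apply hsq
          simp only [s, Finset.coe_image]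
          refine ⟨j, ?_, rfl⟩
          simpa using fun i hi => hj ⟨i, hi⟩
    · intro hq
      have h1 : MvPolynomial.X ((0 : Fin (t + 1)), (⟨0, by omega⟩ : Fin r)) ∈ q.asIdeal :=
        hq (Ideal.subset_span ⟨_, rfl⟩)
      have h2 := hqm h1
      change _ ∈ RingHom.ker (MvPolynomial.eval (pt K t r)) at h2
      rw [RingHom.mem_ker, MvPolynomial.eval_X] at h2
      simp [pt, ht] at h2
  · refine Finset.card_image_le.trans ?_
    rw [Finset.card_sdiff_of_subset (Finset.subset_univ _), Finset.card_image_of_injective _ hg0]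
    simp
  · rw [hn]
    have := height_ker_aux (pt K t r)
    simpa using this

/-- **Lemma on `Δ⁰(l,r)`.** For `3 ≤ l ≤ 2r`, the locus
`Δ⁰(l,r) = {[B] ∈ P(Mat(l,r)) : rank B̃ < l and the first row of B is nonzero}` is locally
closed of codimension exactly `2r - l + 1` in `P(Mat(l,r))`; equivalently its affine cone —
the zero locus of the `l×l` minors of `B̃` minus the locus where the first row vanishes —
is locally closed of dimension `l·r - (2r - l + 1)`. -/
theorem stmt5 (K : Type*) [Field K] (l r : ℕ) (hl : 3 ≤ l) (hlr : l ≤ 2 * r)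
    [NeZero l] :
    IsLocallyClosed
        (zeroLocus (R := MvPolynomial (Fin l × Fin r) K) ↑(minorsIdeal K l r) \
          zeroLocus ↑(firstRowIdeal K l r)) ∧
      topologicalKrullDim
          ((zeroLocus (R := MvPolynomial (Fin l × Fin r) K) ↑(minorsIdeal K l r) \
            zeroLocus ↑(firstRowIdeal K l r) : Set _)) =
        ((l * r - (2 * r - l + 1) : ℕ) : WithBot ℕ∞) := by
  have hV := isClosed_zeroLocus (R := MvPolynomial (Fin l × Fin r) K) ↑(minorsIdeal K l r)
  have hW := isClosed_zeroLocus (R := MvPolynomial (Fin l × Fin r) K) ↑(firstRowIdeal K l r)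
  refine ⟨hV.isLocallyClosed.inter hW.isOpen_compl.isLocallyClosed, ?_⟩
  rw [topDim_eq_krullDim_aux _ _ hV hW]
  obtain ⟨t, rfl⟩ : ∃ t, l = t + 1 := ⟨l - 1, by omega⟩
  obtain ⟨a, rfl⟩ : ∃ a, t = a + 1 := ⟨t - 1, by omega⟩
  have e : (a + 1 + 1) * r = a * r + 2 * r := by ring
  apply le_antisymm
  · refine coheight_le_aux _ _ fun p hp => ?_
    refine (upper_aux K _ r hl p hp.1 hp.2).trans (le_of_eq ?_)
    congr 2
    simp only [Nat.add_sub_cancel, show a + 1 + 1 - 2 = a by omega]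
    omega
  · exact lower_aux K _ r (by omega) hlr _ (by omega)
end

section
/- Let K be a field, 3 ≤ i ≤ l ≤ 2r. Let Δ_i(l,r) be the set of [B] ∈ P(Mat(l,r;K)) such that the i × 2r matrix with rows (b_{k,*}, b_{k-1,*}) for k = 1,…,i (where b_{0,*} = 0) has rank < i, and let Δ_{i-1}(l,r) be defined analogously with i-1 rows. Then the map sending [B] ∈ Δ_i(l,r) \ Δ_{i-1}(l,r) to the pair ([B'], (α₁,…,α_{i-1})), where B' ∈ Mat(l-2, r) is obtained from B by deleting rows i-1 and i, and (α₁,…,α_{i-1}) is the unique coefficient vector expressing the row (b_{i,*}, b_{i-1,*}) as a linear combination of the rows (b_{k,*}, b_{k-1,*}), k = 1,…,i-1, is a well-defined injective map into P(Mat(l-2,r)) × K^{i-1}. -/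
/-- The `k`-th row of the matrix `B̃ ∈ Mat(l, 2r)` attached to `B ∈ Mat(l,r)`: the
concatenation `(b_{k,*}, b_{k-1,*})` of the `k`-th and `(k-1)`-st rows of `B`, with the
convention that the `0`-th row is preceded by the zero row (rows are `0`-indexed here,
corresponding to the `1`-indexed rows of the paper). -/
def extRow {K : Type*} [Field K] {l r : ℕ} (B : Matrix (Fin l) (Fin r) K) (k : Fin l) :
    Fin (r + r) → K :=
  Fin.append (B k) (if h : (k : ℕ) = 0 then 0 else B ⟨(k : ℕ) - 1, by have := k.isLt; omega⟩)

theorem extRow_left {K : Type*} [Field K] {l r : ℕ} (B : Matrix (Fin l) (Fin r) K) (k : Fin l)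
    (j : Fin r) : extRow B k (Fin.castAdd r j) = B k j := by
  simp [extRow]

theorem extRow_right {K : Type*} [Field K] {l r : ℕ} (B : Matrix (Fin l) (Fin r) K) (k : Fin l)
    (j : Fin r) : extRow B k (Fin.natAdd r j) =
      if h : (k : ℕ) = 0 then 0 else B ⟨(k : ℕ) - 1, by have := k.isLt; omega⟩ j := by
  simp only [extRow, Fin.append_right]
  split_ifs <;> rfl

theorem extRow_smul {K : Type*} [Field K] {l r : ℕ} (c : K) (B : Matrix (Fin l) (Fin r) K)
    (k : Fin l) : extRow (c • B) k = c • extRow B k := by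
  funext j
  refine Fin.addCases (fun j => ?_) (fun j => ?_) j
  · simp [extRow_left]
  · simp only [extRow_right, Pi.smul_apply]
    split_ifs <;> simp

theorem coeff_unique {K V : Type*} [Field K] [AddCommGroup V] [Module K V] {n : ℕ}
    {v : Fin n → V} (hv : LinearIndependent K v) {a b : Fin n → K}
    (h : ∑ t, a t • v t = ∑ t, b t • v t) : a = b := by
  rw [Fintype.linearIndependent_iff] at hv
  funext t
  refine sub_eq_zero.mp (hv (fun t => a t - b t) ?_ t)
  simp only [sub_smul, Finset.sum_sub_distrib, h, sub_self]

theorem coeff_exists {K V : Type*} [Field K] [AddCommGroup V] [Module K V] {n : ℕ}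
    {v : Fin (n + 1) → V} (hv : ¬ LinearIndependent K v)
    (hv' : LinearIndependent K (fun t : Fin n => v t.castSucc)) :
    ∃ a : Fin n → K, v (Fin.last n) = ∑ t, a t • v t.castSucc := by
  rw [linearIndependent_finSucc'] at hv
  have h2 : v (Fin.last n) ∈ Submodule.span K (Set.range (fun t : Fin n => v t.castSucc)) := by
    by_contra h
    exact hv ⟨hv', h⟩
  rw [Submodule.mem_span_range_iff_exists_fun] at h2
  obtain ⟨a, ha⟩ := h2
  exact ⟨a, ha.symm⟩

/-- Let `3 ≤ i ≤ l ≤ 2r`, and consider matrices `B` with `[B] ∈ Δ_i(l,r)`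
(the first `i` extended rows `(b_{k,*}, b_{k-1,*})` are linearly dependent) but
`[B] ∉ Δ_{i-1}(l,r)` (the first `i-1` extended rows are linearly independent).  Then:
(1) there is a unique coefficient vector `(α₁,…,α_{i-1})` expressing the `i`-th extended row as
a linear combination of the first `i-1` extended rows; (2) the matrix `B'` obtained by deleting
rows `i-1` and `i` of `B` is nonzero, so `[B']` is a well-defined point of `P(Mat(l-2,r))`;
(3) the resulting map `[B] ↦ ([B'], (α₁,…,α_{i-1})) ∈ P(Mat(l-2,r)) × K^{i-1}` is well defined
and injective on projective classes: for `B, C` in the locus, `[B] = [C]` iff `[B'] = [C']` and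
the coefficient vectors agree. -/
theorem stmt6 {K : Type*} [Field K] (l r i : ℕ) (hi3 : 3 ≤ i) (hil : i ≤ l) (hlr : l ≤ 2 * r) :
    (∀ B : Matrix (Fin l) (Fin r) K,
      ¬ LinearIndependent K (fun t : Fin i => extRow B ⟨t, by have := t.isLt; omega⟩) →
      LinearIndependent K (fun t : Fin (i - 1) => extRow B ⟨t, by have := t.isLt; omega⟩) →
      (∃! α : Fin (i - 1) → K,
          extRow B ⟨i - 1, by omega⟩ =
            ∑ t : Fin (i - 1), α t • extRow B ⟨t, by have := t.isLt; omega⟩) ∧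
        B.submatrix
          (fun k : Fin (l - 2) =>
            if h : (k : ℕ) < i - 2 then (⟨k, by have := k.isLt; omega⟩ : Fin l)
            else ⟨(k : ℕ) + 2, by have := k.isLt; omega⟩) id ≠ 0) ∧
    ∀ B C : Matrix (Fin l) (Fin r) K,
      ¬ LinearIndependent K (fun t : Fin i => extRow B ⟨t, by have := t.isLt; omega⟩) →
      LinearIndependent K (fun t : Fin (i - 1) => extRow B ⟨t, by have := t.isLt; omega⟩) →
      ¬ LinearIndependent K (fun t : Fin i => extRow C ⟨t, by have := t.isLt; omega⟩) →
      LinearIndependent K (fun t : Fin (i - 1) => extRow C ⟨t, by have := t.isLt; omega⟩) →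
      ∀ αB αC : Fin (i - 1) → K,
        extRow B ⟨i - 1, by omega⟩ =
          ∑ t : Fin (i - 1), αB t • extRow B ⟨t, by have := t.isLt; omega⟩ →
        extRow C ⟨i - 1, by omega⟩ =
          ∑ t : Fin (i - 1), αC t • extRow C ⟨t, by have := t.isLt; omega⟩ →
        ((∃ c : K, c ≠ 0 ∧ B = c • C) ↔
          ((∃ c : K, c ≠ 0 ∧
              B.submatrix
                (fun k : Fin (l - 2) =>
                  if h : (k : ℕ) < i - 2 then (⟨k, by have := k.isLt; omega⟩ : Fin l)
                  else ⟨(k : ℕ) + 2, by have := k.isLt; omega⟩) id =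
              c • C.submatrix
                (fun k : Fin (l - 2) =>
                  if h : (k : ℕ) < i - 2 then (⟨k, by have := k.isLt; omega⟩ : Fin l)
                  else ⟨(k : ℕ) + 2, by have := k.isLt; omega⟩) id) ∧
            αB = αC)) := by
  obtain ⟨n, rfl⟩ : ∃ n, i = n + 3 := ⟨i - 3, by omega⟩
  refine ⟨fun B hB hB' => ⟨?_, ?_⟩, ?_⟩
  · obtain ⟨a, ha⟩ := coeff_exists (n := n + 2) hB hB'
    exact ⟨a, ha, fun b hb => coeff_unique hB' (hb.symm.trans ha)⟩
  · intro h0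
    refine hB'.ne_zero (⟨0, by omega⟩ : Fin (n + 3 - 1)) ?_
    funext j
    refine Fin.addCases (fun j => ?_) (fun j => ?_) j
    · have := congrFun (congrFun h0 ⟨0, by omega⟩) j
      simp at this
      simpa [extRow_left] using this
    · rw [extRow_right, dif_pos rfl]; rfl
  · intro B C hB hB' hC hC' a b ha hb
    constructor
    · rintro ⟨c, hc, rfl⟩
      refine ⟨⟨c, hc, rfl⟩, ?_⟩
      refine coeff_unique hC' (Eq.trans ?_ hb)
      simp only [extRow_smul] at ha
      simp only [smul_comm _ c, ← Finset.smul_sum] at ha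
      exact (smul_right_injective _ hc ha).symm
    · rintro ⟨⟨c, hc, h⟩, rfl⟩
      refine ⟨c, hc, ?_⟩
      have low : ∀ k (hk : k < n + 1), ∀ j, B ⟨k, by omega⟩ j = c * C ⟨k, by omega⟩ j := by
        intro k hk j
        have := congrFun (congrFun h ⟨k, by omega⟩) j
        have hk' : k < n + 3 - 2 := by omega
        simp only [Matrix.submatrix_apply, Matrix.smul_apply, hk', dite_true, id,
          smul_eq_mul] at this
        exact this
      have high : ∀ k (hk : n + 3 ≤ k) (hl : k < l), ∀ j, B ⟨k, hl⟩ j = c * C ⟨k, hl⟩ j := by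
        intro k hk hl j
        have := congrFun (congrFun h ⟨k - 2, by omega⟩) j
        have hk' : ¬ (k - 2 < n + 3 - 2) := by omega
        have hk2 : k - 2 + 2 = k := by omega
        simp only [Matrix.submatrix_apply, Matrix.smul_apply, hk', dite_false, hk2, id,
          smul_eq_mul] at this
        exact this
      have mid : ∀ j, B ⟨n + 1, by omega⟩ j = c * C ⟨n + 1, by omega⟩ j := by
        intro j
        have h1 := congrFun ha (Fin.natAdd r j)
        have h2 := congrFun hb (Fin.natAdd r j)
        simp only [Finset.sum_apply, Pi.smul_apply, extRow_right] at h1 h2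
        rw [dif_neg (by omega)] at h1 h2
        refine h1.trans (Eq.trans ?_ (congrArg (c * ·) h2).symm)
        simp only [Finset.mul_sum]
        refine Finset.sum_congr rfl fun t _ => ?_
        split_ifs with h0
        · simp
        · rw [low _ (by have := t.isLt; omega)]
          simp only [smul_eq_mul]; ring
      have low2 : ∀ k (hk : k < n + 2), ∀ j, B ⟨k, by omega⟩ j = c * C ⟨k, by omega⟩ j := by
        intro k hk j
        rcases Nat.lt_succ_iff_lt_or_eq.mp hk with h' | rfl
        · exact low k h' j
        · exact mid j
      have top : ∀ j, B ⟨n + 2, by omega⟩ j = c * C ⟨n + 2, by omega⟩ j := by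
        intro j
        have h1 := congrFun ha (Fin.castAdd r j)
        have h2 := congrFun hb (Fin.castAdd r j)
        simp only [Finset.sum_apply, Pi.smul_apply, extRow_left] at h1 h2
        refine h1.trans (Eq.trans ?_ (congrArg (c * ·) h2).symm)
        simp only [Finset.mul_sum]
        refine Finset.sum_congr rfl fun t _ => ?_
        rw [low2 _ (by have := t.isLt; omega)]
        simp only [smul_eq_mul]; ring
      ext ⟨k, hk⟩ j
      rw [Matrix.smul_apply, smul_eq_mul]
      rcases lt_trichotomy k (n + 2) with h' | rfl | h'
      · exact low2 k h' j
      · exact top j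
      · exact high k h' hk j
end
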